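/- There exists a constant c such that for all compactly supported C^{3,1} functions h on ℝ², ‖h‖_{L⁸(ℝ²)} ≤ c ‖∂_t h + ∂_x³ h − 3∂_x² h − h‖_{L^{8/7}(ℝ²)}. -/

import Mathlib

open MeasureTheory

noncomputable def pdx (f : ℝ × ℝ → ℝ) : ℝ × ℝ → ℝ := fun p => deriv (fun x => f (x, p.2)) p.1
noncomputable def pdt (f : ℝ × ℝ → ℝ) : ℝ × ℝ → ℝ := fun p => deriv (fun t => f (p.1, t)) p.2

/-- `f ∈ C^{3,1}`: three continuous spatial derivatives and one continuous time derivative. -/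
def C31 (f : ℝ × ℝ → ℝ) : Prop :=
  (∀ t, ContDiff ℝ 3 (fun x => f (x, t))) ∧ (∀ x, Differentiable ℝ (fun t => f (x, t))) ∧
  Continuous f ∧ Continuous (pdx f) ∧ Continuous (pdx (pdx f)) ∧
  Continuous (pdx (pdx (pdx f))) ∧ Continuous (pdt f)

open Complex in
theorem integral_abs_deriv_of_sign {u u' : ℝ → ℝ} {a b : ℝ} (hab : a ≤ b)
    (hu : ∀ x ∈ Set.Icc a b, HasDerivAt u (u' x) x) (hc : ContinuousOn u' (Set.Icc a b))
    (hs : (∀ x ∈ Set.Icc a b, 0 ≤ u' x) ∨ (∀ x ∈ Set.Icc a b, u' x ≤ 0)) :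
    ∫ x in a..b, |u' x| = |u b - u a| := by
  have hI : ∫ x in a..b, u' x = u b - u a := by
    apply intervalIntegral.integral_eq_sub_of_hasDerivAt
    · rwa [Set.uIcc_of_le hab]
    · exact (hc.mono (by rw [Set.uIcc_of_le hab])).intervalIntegrable
  rcases hs with hs | hs
  · have h1 : ∫ x in a..b, |u' x| = ∫ x in a..b, u' x :=
      intervalIntegral.integral_congr fun x hx => by
        rw [Set.uIcc_of_le hab] at hx
        exact abs_of_nonneg (hs x hx)
    rw [h1, ← hI, abs_of_nonneg]
    exact intervalIntegral.integral_nonneg hab hs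
  · have h1 : ∫ x in a..b, |u' x| = ∫ x in a..b, -u' x :=
      intervalIntegral.integral_congr fun x hx => by
        rw [Set.uIcc_of_le hab] at hx
        exact abs_of_nonpos (hs x hx)
    rw [h1, ← hI, intervalIntegral.integral_neg, abs_of_nonpos]
    have := intervalIntegral.integral_nonneg hab (f := fun x => - u' x) (μ := volume)
      (fun x hx => by linarith [hs x hx])
    rw [intervalIntegral.integral_neg] at this
    linarith

open Complex in
/-- First-derivative van der Corput estimate with a monotone amplitude. -/
theorem norm_integral_cexp_le_of_le_deriv {φ φ' φ'' ψ ψ' : ℝ → ℝ} {a b l : ℝ} (hab : a ≤ b)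
    (hl : 0 < l) (hφ : ∀ x, HasDerivAt φ (φ' x) x) (hφ' : ∀ x, HasDerivAt φ' (φ'' x) x)
    (hφc : Continuous φ'') (hψ : ∀ x, HasDerivAt ψ (ψ' x) x) (hψc : Continuous ψ')
    (h1 : ∀ x ∈ Set.Icc a b, l ≤ φ' x)
    (h2 : (∀ x ∈ Set.Icc a b, 0 ≤ φ'' x) ∨ (∀ x ∈ Set.Icc a b, φ'' x ≤ 0))
    (h3 : ∀ x ∈ Set.Icc a b, 0 ≤ ψ x ∧ ψ x ≤ 1)
    (h4 : (∀ x ∈ Set.Icc a b, 0 ≤ ψ' x) ∨ (∀ x ∈ Set.Icc a b, ψ' x ≤ 0)) :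
    ‖∫ x in a..b, cexp (φ x * I) * ψ x‖ ≤ 4 / l := by
  have cφ : Continuous φ := continuous_iff_continuousAt.2 fun x => (hφ x).continuousAt
  have cφ' : Continuous φ' := continuous_iff_continuousAt.2 fun x => (hφ' x).continuousAt
  have cψ : Continuous ψ := continuous_iff_continuousAt.2 fun x => (hψ x).continuousAt
  have hpos : ∀ x ∈ Set.Icc a b, 0 < φ' x := fun x hx => hl.trans_le (h1 x hx)
  have hne : ∀ x ∈ Set.Icc a b, φ' x ≠ 0 := fun x hx => (hpos x hx).ne'
  have hinv : ∀ x ∈ Set.Icc a b,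
      HasDerivAt (fun y => (φ' y)⁻¹) (-φ'' x / φ' x ^ 2) x :=
    fun x hx => (hφ' x).inv (hne x hx)
  have cinv : ContinuousOn (fun x => -φ'' x / φ' x ^ 2) (Set.Icc a b) :=
    (hφc.neg.continuousOn).div (cφ'.pow 2).continuousOn fun x hx => pow_ne_zero _ (hne x hx)
  have cinv0 : ContinuousOn (fun x => (φ' x)⁻¹) (Set.Icc a b) :=
    cφ'.continuousOn.inv₀ hne
  have ha : a ∈ Set.Icc a b := ⟨le_rfl, hab⟩
  have hb : b ∈ Set.Icc a b := ⟨hab, le_rfl⟩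
  have hinvb : ∀ x ∈ Set.Icc a b, 0 ≤ (φ' x)⁻¹ ∧ (φ' x)⁻¹ ≤ l⁻¹ := fun x hx =>
    ⟨(inv_pos.2 (hpos x hx)).le, inv_anti₀ hl (h1 x hx)⟩
  let R : ℝ → ℝ := fun x => ψ' x * (φ' x)⁻¹ + ψ x * (-φ'' x / φ' x ^ 2)
  have cR : ContinuousOn R (Set.Icc a b) :=
    (hψc.continuousOn.mul cinv0).add (cψ.continuousOn.mul cinv)
  have hE : ∀ x, HasDerivAt (fun y : ℝ => cexp (φ y * I)) (cexp (φ x * I) * (φ' x * I)) x :=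
    fun x => ((hφ x).ofReal_comp.mul_const I).cexp
  have cE : Continuous (fun y : ℝ => cexp (φ y * I)) := by fun_prop
  have hD : ∀ x ∈ Set.uIcc a b,
      HasDerivAt (fun y : ℝ => cexp (φ y * I) * ((ψ y * (φ' y)⁻¹ : ℝ) : ℂ))
        (I * (cexp (φ x * I) * ψ x) + cexp (φ x * I) * (R x : ℂ)) x := by
    intro x hx
    rw [Set.uIcc_of_le hab] at hx
    have := (hE x).mul ((hψ x).mul (hinv x hx)).ofReal_comp
    refine this.congr_deriv ?_
    have hne' : (φ' x : ℂ) ≠ 0 := by exact_mod_cast hne x hx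
    simp only [R, Pi.mul_apply]
    push_cast
    field_simp
  have i1 : IntervalIntegrable (fun x => I * (cexp (φ x * I) * ψ x)) volume a b :=
    (by fun_prop : Continuous (fun x : ℝ => I * (cexp (φ x * I) * (ψ x : ℂ)))).intervalIntegrable
      _ _
  have i2 : IntervalIntegrable (fun x => cexp (φ x * I) * (R x : ℂ)) volume a b := by
    apply ContinuousOn.intervalIntegrable
    rw [Set.uIcc_of_le hab]
    exact cE.continuousOn.mul (continuous_ofReal.comp_continuousOn cR)
  have key := intervalIntegral.integral_eq_sub_of_hasDerivAt hD (i1.add i2)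
  rw [intervalIntegral.integral_add i1 i2, intervalIntegral.integral_const_mul] at key
  have nE : ∀ x : ℝ, ‖cexp (φ x * I)‖ = 1 := fun x => norm_exp_ofReal_mul_I _
  have bd : ∀ x ∈ Set.Icc a b,
      ‖cexp (φ x * I) * ((ψ x * (φ' x)⁻¹ : ℝ) : ℂ)‖ ≤ l⁻¹ := by
    intro x hx
    rw [norm_mul, nE, one_mul, norm_real, Real.norm_eq_abs, abs_of_nonneg
      (mul_nonneg (h3 x hx).1 (hinvb x hx).1)]
    calc ψ x * (φ' x)⁻¹ ≤ 1 * l⁻¹ := by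
          gcongr
          · exact (hinvb x hx).1
          · exact (h3 x hx).2
          · exact (h1 x hx)
      _ = _ := one_mul _
  have iR1 : IntervalIntegrable (fun x => |ψ' x|) volume a b := hψc.abs.intervalIntegrable _ _
  have iR2 : IntervalIntegrable (fun x => |-φ'' x / φ' x ^ 2|) volume a b := by
    apply ContinuousOn.intervalIntegrable
    rw [Set.uIcc_of_le hab]
    exact cinv.abs
  have rest : ‖∫ x in a..b, cexp (φ x * I) * (R x : ℂ)‖ ≤ 2 * l⁻¹ := by
    calc ‖∫ x in a..b, cexp (φ x * I) * (R x : ℂ)‖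
        ≤ ∫ x in a..b, (l⁻¹ * |ψ' x| + |-φ'' x / φ' x ^ 2|) := by
          apply intervalIntegral.norm_integral_le_of_norm_le hab
          · refine Filter.Eventually.of_forall fun x hx' => ?_
            have hx := Set.Ioc_subset_Icc_self hx'
            rw [norm_mul, nE, one_mul, norm_real, Real.norm_eq_abs]
            refine (abs_add_le _ _).trans ?_
            rw [abs_mul, abs_mul, abs_of_nonneg (hinvb x hx).1, abs_of_nonneg (h3 x hx).1]
            gcongr ?_ + ?_
            · rw [mul_comm]
              exact mul_le_mul_of_nonneg_right (hinvb x hx).2 (abs_nonneg _)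
            · exact mul_le_of_le_one_left (abs_nonneg _) (h3 x hx).2
          · exact (iR1.const_mul _).add iR2
      _ = l⁻¹ * |ψ b - ψ a| + |(φ' b)⁻¹ - (φ' a)⁻¹| := by
          rw [intervalIntegral.integral_add (iR1.const_mul _) iR2,
            intervalIntegral.integral_const_mul,
            integral_abs_deriv_of_sign hab (fun x _ => hψ x) hψc.continuousOn h4,
            integral_abs_deriv_of_sign hab hinv cinv]
          rcases h2 with h2 | h2
          · exact Or.inr fun x hx => div_nonpos_of_nonpos_of_nonneg (by linarith [h2 x hx])
              (sq_nonneg _)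
          · exact Or.inl fun x hx => div_nonneg (by linarith [h2 x hx]) (sq_nonneg _)
      _ ≤ l⁻¹ * 1 + l⁻¹ := by
          have := h3 a ha; have := h3 b hb; have := hinvb a ha; have := hinvb b hb
          gcongr
          · rw [abs_le]; constructor <;> linarith
          · rw [abs_le]; constructor <;> linarith
      _ = 2 * l⁻¹ := by ring
  have : I * ∫ x in a..b, cexp (φ x * I) * ψ x =
      (cexp (φ b * I) * ((ψ b * (φ' b)⁻¹ : ℝ) : ℂ) - cexp (φ a * I) * ((ψ a * (φ' a)⁻¹ : ℝ) : ℂ))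
        - ∫ x in a..b, cexp (φ x * I) * (R x : ℂ) := by
    rw [← key]; ring
  calc ‖∫ x in a..b, cexp (φ x * I) * ψ x‖ = ‖I * ∫ x in a..b, cexp (φ x * I) * ψ x‖ := by simp
    _ ≤ (l⁻¹ + l⁻¹) + 2 * l⁻¹ := by
      rw [this]
      refine (norm_sub_le _ _).trans (add_le_add ((norm_sub_le _ _).trans ?_) rest)
      exact add_le_add (bd b hb) (bd a ha)
    _ = 4 / l := by ring

open Complex in
theorem conj_integral_cexp (φ ψ : ℝ → ℝ) (a b : ℝ) :
    (starRingEnd ℂ) (∫ x in a..b, cexp (φ x * I) * ψ x) =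
      ∫ x in a..b, cexp ((-φ x : ℝ) * I) * ψ x := by
  simp only [intervalIntegral, map_sub, ← integral_conj, map_mul, ← exp_conj, conj_ofReal, conj_I,
    ofReal_neg, mul_neg, neg_mul]

open Complex in
/-- Uniform decay of oscillatory integrals with cubic phase and monotone amplitude. -/
theorem norm_integral_cubic_phase_le {ψ ψ' : ℝ → ℝ} {a b m x : ℝ} (ha : 0 ≤ a) (hab : a ≤ b)
    (hm : 0 < m) (hψ : ∀ w, HasDerivAt ψ (ψ' w) w) (hψc : Continuous ψ')
    (h3 : ∀ w ∈ Set.Icc a b, 0 ≤ ψ w ∧ ψ w ≤ 1)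
    (h4 : (∀ w ∈ Set.Icc a b, 0 ≤ ψ' w) ∨ (∀ w ∈ Set.Icc a b, ψ' w ≤ 0)) :
    ‖∫ w in a..b, cexp ((x * w + m ^ 3 * w ^ 3 : ℝ) * I) * ψ w‖ ≤ 5 / m := by
  obtain ⟨r, hr0, hr1, hr2⟩ : ∃ r : ℝ, 0 ≤ r ∧ -(3 * m ^ 3 * r ^ 2) ≤ x ∧
      (0 < r → x = -(3 * m ^ 3 * r ^ 2)) := by
    rcases le_total 0 x with hx | hx
    · exact ⟨0, le_rfl, by simpa using hx, fun h => absurd h (lt_irrefl _)⟩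
    · have h : x = -(3 * m ^ 3 * (Real.sqrt (-x / (3 * m ^ 3))) ^ 2) := by
        rw [Real.sq_sqrt (div_nonneg (by linarith) (by positivity))]
        field_simp
      exact ⟨_, Real.sqrt_nonneg _, h.ge, fun _ => h⟩
  set d : ℝ := 1 / m with hd
  have hd0 : 0 < d := by positivity
  have hmd : m ^ 3 * d ^ 2 = m := by rw [hd]; field_simp
  set p := max a (min b (r - d)) with hp
  set q := max a (min b (r + d)) with hq
  have hap : a ≤ p := le_max_left _ _
  have haq : a ≤ q := le_max_left _ _
  have hpq : p ≤ q := max_le_max le_rfl (min_le_min le_rfl (by linarith))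
  have hqb : q ≤ b := max_le hab (min_le_left _ _)
  have hpb : p ≤ b := hpq.trans hqb
  set φ : ℝ → ℝ := fun w => x * w + m ^ 3 * w ^ 3 with hφ
  set φ' : ℝ → ℝ := fun w => x + 3 * m ^ 3 * w ^ 2 with hφ'
  set φ'' : ℝ → ℝ := fun w => 6 * m ^ 3 * w with hφ''
  have d1 : ∀ w, HasDerivAt φ (φ' w) w := fun w => by
    have := ((hasDerivAt_id w).const_mul x).add ((hasDerivAt_pow 3 w).const_mul (m ^ 3))
    refine this.congr_deriv ?_
    simp only [hφ']; push_cast; ring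
  have d2 : ∀ w, HasDerivAt φ' (φ'' w) w := fun w => by
    have := ((hasDerivAt_pow 2 w).const_mul (3 * m ^ 3)).const_add x
    refine this.congr_deriv ?_
    simp only [hφ'']; push_cast; ring
  have cψ : Continuous ψ := continuous_iff_continuousAt.2 fun x => (hψ x).continuousAt
  have cont : Continuous fun w : ℝ => cexp (φ w * I) * ψ w := by fun_prop
  have ii : ∀ s t : ℝ, IntervalIntegrable (fun w : ℝ => cexp (φ w * I) * ψ w) volume s t :=
    fun s t => cont.intervalIntegrable _ _
  have s1 : ‖∫ w in a..p, cexp (φ w * I) * ψ w‖ ≤ 4 / (3 * m) := by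
    rcases hap.eq_or_lt with h | h
    · rw [← h, intervalIntegral.integral_same, norm_zero]; positivity
    · have hpr : p ≤ r - d := by
        rcases le_max_iff.1 (le_refl p) with h' | h'
        · exact absurd h' (not_le.2 h)
        · exact h'.trans (min_le_right _ _)
      have hrd : d ≤ r := by linarith
      rw [← RCLike.norm_conj, conj_integral_cexp]
      refine norm_integral_cexp_le_of_le_deriv (φ := fun w => - φ w) (φ' := fun w => - φ' w)
        (φ'' := fun w => - φ'' w) hap (by positivity) (fun w => (d1 w).neg) (fun w => (d2 w).neg)
        (by fun_prop) hψ hψc ?_ (Or.inr ?_) (fun w hw => h3 w ⟨hw.1, hw.2.trans hpb⟩)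
        (h4.imp (fun h w hw => h w ⟨hw.1, hw.2.trans hpb⟩)
          (fun h w hw => h w ⟨hw.1, hw.2.trans hpb⟩))
      · intro w hw
        have hw0 : 0 ≤ w := ha.trans hw.1
        have hwr : w ≤ r - d := hw.2.trans hpr
        have : d ^ 2 ≤ r ^ 2 - w ^ 2 := by nlinarith
        have h5 : m ^ 3 * d ^ 2 ≤ m ^ 3 * (r ^ 2 - w ^ 2) := by gcongr
        simp only [hφ']
        rw [hr2 (by linarith)]
        linarith
      · intro w hw
        have hw0 : 0 ≤ w := ha.trans hw.1
        have : 0 ≤ φ'' w := by positivity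
        linarith
  have s2 : ‖∫ w in p..q, cexp (φ w * I) * ψ w‖ ≤ 2 / m := by
    calc _ ≤ 1 * |q - p| := by
          apply intervalIntegral.norm_integral_le_of_norm_le_const
          intro w hw
          rw [Set.uIoc_of_le hpq] at hw
          have := h3 w ⟨hap.trans hw.1.le, hw.2.trans hqb⟩
          rw [norm_mul, norm_exp_ofReal_mul_I, one_mul, norm_real, Real.norm_eq_abs,
            abs_of_nonneg this.1]
          exact this.2
      _ ≤ 2 / m := by
          rw [one_mul, abs_of_nonneg (by linarith)]
          have h6 : q ≤ p + 2 * d := by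
            rw [hp, hq]
            refine max_le ?_ ?_
            · have := le_max_left a (min b (r - d)); linarith
            · have h7 := le_max_right a (min b (r - d))
              rcases min_cases b (r - d) with h | h
              · have := min_le_left b (r + d); linarith
              · have := min_le_right b (r + d); linarith
          have : 2 / m = 2 * d := by rw [hd]; ring
          linarith
  have s3 : ‖∫ w in q..b, cexp (φ w * I) * ψ w‖ ≤ 4 / (3 * m) := by
    rcases hqb.eq_or_lt with h | h
    · rw [h, intervalIntegral.integral_same, norm_zero]; positivity
    · have hqr : r + d ≤ q := by
        by_contra h'
        push Not at h'
        have : min b (r + d) ≤ q := le_max_right _ _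
        rcases min_cases b (r + d) with h'' | h'' <;> linarith
      refine norm_integral_cexp_le_of_le_deriv hqb (by positivity) d1 d2
        (by fun_prop) hψ hψc ?_ (Or.inl ?_) (fun w hw => h3 w ⟨haq.trans hw.1, hw.2⟩)
        (h4.imp (fun h w hw => h w ⟨haq.trans hw.1, hw.2⟩)
          (fun h w hw => h w ⟨haq.trans hw.1, hw.2⟩))
      · intro w hw
        have hwr : r + d ≤ w := hqr.trans hw.1
        have : d ^ 2 ≤ w ^ 2 - r ^ 2 := by nlinarith
        have h5 : m ^ 3 * d ^ 2 ≤ m ^ 3 * (w ^ 2 - r ^ 2) := by gcongr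
        simp only [hφ']
        linarith
      · intro w hw
        have hw0 : 0 ≤ w := (ha.trans haq).trans hw.1
        positivity
  rw [← intervalIntegral.integral_add_adjacent_intervals (ii a q) (ii q b),
    ← intervalIntegral.integral_add_adjacent_intervals (ii a p) (ii p q)]
  calc _ ≤ (4 / (3 * m) + 2 / m) + 4 / (3 * m) :=
        (norm_add_le _ _).trans (add_le_add ((norm_add_le _ _).trans (add_le_add s1 s2)) s3)
    _ ≤ 5 / m := by
        rw [show 4 / (3 * m) + 2 / m + 4 / (3 * m) = (14 / 3) / m by field_simp; ring]
        gcongr; norm_num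

open Complex in
/-- The Fourier symbol `(iw)³` moved to the right side: `∂ₜ u = carlemanSymbol u + F` is the
equation `∂ₜ h + ∂ₓ³ h - 3 ∂ₓ² h - h = F` in Fourier variables. -/
noncomputable def carlemanSymbol (w : ℝ) : ℂ := I * w ^ 3 + (1 - 3 * w ^ 2 : ℝ)

open Complex in
/-- The bounded Fourier multiplier of the fundamental solution at time `τ`. -/
noncomputable def carlemanMult (τ w : ℝ) : ℂ :=
  if 0 < τ then (if 1 < 3 * w ^ 2 then cexp (τ * carlemanSymbol w) else 0)
  else (if 3 * w ^ 2 ≤ 1 then -cexp (τ * carlemanSymbol w) else 0)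

open Complex in
theorem norm_cexp_carlemanSymbol (τ w : ℝ) :
    ‖cexp (τ * carlemanSymbol w)‖ = Real.exp (τ * (1 - 3 * w ^ 2)) := by
  have : (τ * carlemanSymbol w : ℂ) = (τ * (1 - 3 * w ^ 2) : ℝ) + (τ * w ^ 3 : ℝ) * I := by
    simp only [carlemanSymbol]; push_cast; ring
  rw [this, exp_add, norm_mul, norm_exp_ofReal_mul_I, mul_one, ← ofReal_exp, norm_real,
    Real.norm_eq_abs, Real.abs_exp]

theorem continuous_carlemanSymbol : Continuous carlemanSymbol := by
  unfold carlemanSymbol; fun_prop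

theorem measurable_carlemanMult : Measurable (fun p : ℝ × ℝ => carlemanMult p.1 p.2) := by
  unfold carlemanMult
  have := continuous_carlemanSymbol.measurable
  refine Measurable.ite (measurableSet_lt (by fun_prop) (by fun_prop)) ?_ ?_
  · exact Measurable.ite (measurableSet_lt (by fun_prop) (by fun_prop)) (by fun_prop) (by fun_prop)
  · exact Measurable.ite (measurableSet_le (by fun_prop) (by fun_prop)) (by fun_prop) (by fun_prop)

theorem norm_carlemanMult_le_one (τ w : ℝ) : ‖carlemanMult τ w‖ ≤ 1 := by
  unfold carlemanMult
  split_ifs with h1 h2 h2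
  · rw [norm_cexp_carlemanSymbol, Real.exp_le_one_iff]
    nlinarith
  · simp
  · rw [norm_neg, norm_cexp_carlemanSymbol, Real.exp_le_one_iff]
    nlinarith
  · simp

theorem exp_neg_le_rpow {y : ℝ} (hy : 0 < y) : Real.exp (-y) ≤ y ^ (-3 / 4 : ℝ) := by
  have h1 : y ^ (3 / 4 : ℝ) ≤ Real.exp y := by
    calc y ^ (3 / 4 : ℝ) ≤ (Real.exp y) ^ (3 / 4 : ℝ) :=
          Real.rpow_le_rpow hy.le (by linarith [Real.add_one_le_exp y]) (by norm_num)
      _ = Real.exp (y * (3 / 4)) := by rw [← Real.exp_mul]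
      _ ≤ Real.exp y := Real.exp_le_exp.2 (by linarith)
  rw [Real.exp_neg, neg_div, Real.rpow_neg hy.le]
  exact inv_anti₀ (by positivity) h1

theorem norm_carlemanMult_le (τ w : ℝ) :
    ‖carlemanMult τ w‖ ≤ 6 * (1 + |τ| ^ (-3 / 4 : ℝ)) * (1 + w ^ 2) ^ (-3 / 4 : ℝ) := by
  have h0 : 0 < 1 + w ^ 2 := by positivity
  have h2pow : (1 / 2 : ℝ) ^ (-3 / 4 : ℝ) ≤ 2 := by
    rw [one_div, Real.inv_rpow (by norm_num), neg_div, Real.rpow_neg (by norm_num), inv_inv]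
    calc (2 : ℝ) ^ (3 / 4 : ℝ) ≤ 2 ^ (1 : ℝ) :=
          Real.rpow_le_rpow_of_exponent_le (by norm_num) (by norm_num)
      _ = 2 := Real.rpow_one 2
  have he : Real.exp 1 ≤ 3 := Real.exp_one_lt_three.le
  have main : ∀ t : ℝ, 0 < t → t ≤ 1 → 1 < 3 * w ^ 2 →
      Real.exp (t * (1 - 3 * w ^ 2)) ≤ 6 * t ^ (-3 / 4 : ℝ) * (1 + w ^ 2) ^ (-3 / 4 : ℝ) := by
    intro t ht ht1 hw
    calc Real.exp (t * (1 - 3 * w ^ 2)) = Real.exp t * Real.exp (-(t * (3 * w ^ 2))) := by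
          rw [← Real.exp_add]; ring_nf
      _ ≤ Real.exp 1 * Real.exp (-(t * ((1 / 2) * (1 + w ^ 2)))) := by
          refine mul_le_mul (Real.exp_le_exp.2 ht1) (Real.exp_le_exp.2 (neg_le_neg ?_))
            (Real.exp_pos _).le (Real.exp_pos _).le
          exact mul_le_mul_of_nonneg_left (by linarith) ht.le
      _ ≤ 3 * (t * ((1 / 2) * (1 + w ^ 2))) ^ (-3 / 4 : ℝ) := by
          gcongr
          exact exp_neg_le_rpow (by positivity)
      _ = 3 * (t ^ (-3 / 4 : ℝ) * ((1 / 2) ^ (-3 / 4 : ℝ) * (1 + w ^ 2) ^ (-3 / 4 : ℝ))) := by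
          rw [Real.mul_rpow ht.le (by positivity), Real.mul_rpow (by norm_num) h0.le]
      _ ≤ 3 * (t ^ (-3 / 4 : ℝ) * (2 * (1 + w ^ 2) ^ (-3 / 4 : ℝ))) := by gcongr
      _ = _ := by ring
  unfold carlemanMult
  split_ifs with h1 h2 h2
  · rw [norm_cexp_carlemanSymbol, abs_of_pos h1]
    rcases le_total τ 1 with h | h
    · refine (main τ h1 h h2).trans ?_
      gcongr
      linarith
    · calc Real.exp (τ * (1 - 3 * w ^ 2)) ≤ Real.exp (1 * (1 - 3 * w ^ 2)) := by
            apply Real.exp_le_exp.2; nlinarith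
        _ ≤ 6 * 1 ^ (-3 / 4 : ℝ) * (1 + w ^ 2) ^ (-3 / 4 : ℝ) := main 1 one_pos le_rfl h2
        _ ≤ _ := by
          rw [Real.one_rpow]
          gcongr
          have : 0 ≤ τ ^ (-3 / 4 : ℝ) := by positivity
          linarith
  · rw [norm_zero]; positivity
  · have h3 : (1 / 2 : ℝ) ≤ (1 + w ^ 2) ^ (-3 / 4 : ℝ) := by
      rw [neg_div, Real.rpow_neg h0.le, one_div]
      refine inv_anti₀ (by positivity) ?_
      calc (1 + w ^ 2) ^ (3 / 4 : ℝ) ≤ (1 + w ^ 2) ^ (1 : ℝ) :=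
            Real.rpow_le_rpow_of_exponent_le (by nlinarith) (by norm_num)
        _ ≤ 2 := by rw [Real.rpow_one]; linarith
    rw [norm_neg, norm_cexp_carlemanSymbol]
    have h4 : Real.exp (τ * (1 - 3 * w ^ 2)) ≤ 1 := by
      rw [Real.exp_le_one_iff]; nlinarith
    have h5 : 0 ≤ |τ| ^ (-3 / 4 : ℝ) := by positivity
    nlinarith
  · rw [norm_zero]; positivity

theorem integrable_one_add_sq_rpow :
    Integrable (fun w : ℝ => (1 + w ^ 2) ^ (-3 / 4 : ℝ)) := by
  have := integrable_rpow_neg_one_add_norm_sq (E := ℝ) (μ := volume) (r := 3 / 2)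
    (by simp; norm_num)
  refine this.congr (Filter.Eventually.of_forall fun w => ?_)
  simp only [Real.norm_eq_abs, sq_abs]
  norm_num

theorem integrable_carlemanMult (τ : ℝ) : Integrable (carlemanMult τ) := by
  refine (integrable_one_add_sq_rpow.const_mul (6 * (1 + |τ| ^ (-3 / 4 : ℝ)))).mono' ?_ ?_
  · exact (measurable_carlemanMult.comp
      (by fun_prop : Measurable fun w : ℝ => (τ, w))).aestronglyMeasurable
  · exact Filter.Eventually.of_forall fun w => norm_carlemanMult_le τ w

open Complex in
theorem carlemanMult_neg (τ w : ℝ) :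
    carlemanMult τ (-w) = (starRingEnd ℂ) (carlemanMult τ w) := by
  have : cexp (τ * carlemanSymbol (-w)) = (starRingEnd ℂ) (cexp (τ * carlemanSymbol w)) := by
    rw [← exp_conj]
    congr 1
    simp only [carlemanSymbol, map_mul, map_add, conj_ofReal, conj_I, map_pow]
    push_cast; ring
  unfold carlemanMult
  rw [this, neg_sq]
  split_ifs <;> simp

open Complex in
theorem cexp_carlemanSymbol_mul (τ x w : ℝ) :
    cexp (τ * carlemanSymbol w) * cexp (x * w * I) =
      cexp ((x * w + τ * w ^ 3 : ℝ) * I) * Real.exp (τ * (1 - 3 * w ^ 2)) := by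
  rw [ofReal_exp, ← exp_add, ← exp_add]
  congr 1
  simp only [carlemanSymbol]; push_cast; ring

open Complex in
theorem norm_integral_Ioi_carlemanMult_le {m τ : ℝ} (hm : 0 < m) (hτ : |τ| = m ^ 3) (x : ℝ) :
    ‖∫ w in Set.Ioi 0, carlemanMult τ w * cexp (x * w * I)‖ ≤ 5 / m := by
  obtain ⟨a, ha0, ha⟩ : ∃ a : ℝ, 0 < a ∧ 3 * a ^ 2 = 1 :=
    ⟨(Real.sqrt 3)⁻¹, by positivity, by rw [inv_pow, Real.sq_sqrt (by norm_num)]; norm_num⟩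
  have hψ : ∀ w, HasDerivAt (fun w => Real.exp (τ * (1 - 3 * w ^ 2)))
      (Real.exp (τ * (1 - 3 * w ^ 2)) * (-6 * τ * w)) w := fun w => by
    have := ((((hasDerivAt_pow 2 w).const_mul 3).const_sub 1).const_mul τ).exp
    refine this.congr_deriv ?_
    push_cast; ring
  have hψc : Continuous fun w => Real.exp (τ * (1 - 3 * w ^ 2)) * (-6 * τ * w) := by fun_prop
  have hInt : Integrable fun w : ℝ => carlemanMult τ w * cexp (x * w * I) := by
    refine (integrable_carlemanMult τ).mul_bdd (c := 1) (by fun_prop)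
      (Filter.Eventually.of_forall fun w => ?_)
    rw [← ofReal_mul, norm_exp_ofReal_mul_I]
  rcases lt_or_ge 0 τ with h | h
  · have hlim := intervalIntegral_tendsto_integral_Ioi 0 hInt.integrableOn Filter.tendsto_id
    refine le_of_tendsto hlim.norm ?_
    filter_upwards [Filter.eventually_ge_atTop a] with N hN
    simp only [id]
    have hN0 : 0 ≤ N := ha0.le.trans hN
    rw [abs_of_pos h] at hτ
    have e1 : ∫ w in (0)..a, carlemanMult τ w * cexp (x * w * I) = 0 := by
      rw [intervalIntegral.integral_of_le ha0.le]
      refine setIntegral_eq_zero_of_forall_eq_zero fun w hw => ?_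
      have : ¬ 1 < 3 * w ^ 2 := by have := hw.1; have := hw.2; nlinarith
      simp [carlemanMult, h, this]
    have e2 : ∫ w in a..N, carlemanMult τ w * cexp (x * w * I) =
        ∫ w in a..N, cexp ((x * w + m ^ 3 * w ^ 3 : ℝ) * I) * Real.exp (τ * (1 - 3 * w ^ 2)) := by
      rw [intervalIntegral.integral_of_le hN, intervalIntegral.integral_of_le hN]
      refine setIntegral_congr_fun measurableSet_Ioc fun w hw => ?_
      have : 1 < 3 * w ^ 2 := by have := hw.1; nlinarith
      simp only [carlemanMult, h, this, if_true]
      rw [cexp_carlemanSymbol_mul, hτ]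
    rw [← intervalIntegral.integral_add_adjacent_intervals hInt.intervalIntegrable
      hInt.intervalIntegrable (b := a), e1, zero_add, e2]
    refine norm_integral_cubic_phase_le ha0.le hN hm hψ hψc ?_ (Or.inr ?_)
    · intro w hw
      refine ⟨(Real.exp_pos _).le, ?_⟩
      rw [Real.exp_le_one_iff]
      have : 1 ≤ 3 * w ^ 2 := by have := hw.1; nlinarith
      nlinarith
    · intro w hw
      have hw0 : 0 ≤ w := ha0.le.trans hw.1
      have : 0 ≤ Real.exp (τ * (1 - 3 * w ^ 2)) * (6 * τ * w) := by positivity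
      linarith
  · rw [abs_of_nonpos h] at hτ
    have e1 : ∫ w in Set.Ioi 0, carlemanMult τ w * cexp (x * w * I) =
        -∫ w in (0)..a, cexp ((-(-x * w + m ^ 3 * w ^ 3) : ℝ) * I) *
          Real.exp (τ * (1 - 3 * w ^ 2)) := by
      rw [intervalIntegral.integral_of_le ha0.le, ← integral_neg,
        ← integral_indicator measurableSet_Ioi, ← integral_indicator measurableSet_Ioc]
      congr 1
      ext w
      by_cases hw : 0 < w
      · by_cases hwa : w ≤ a
        · have : 3 * w ^ 2 ≤ 1 := by nlinarith
          rw [Set.indicator_of_mem (show w ∈ Set.Ioi 0 from hw),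
            Set.indicator_of_mem (show w ∈ Set.Ioc 0 a from ⟨hw, hwa⟩)]
          simp only [carlemanMult, h.not_gt, this, if_true, if_false]
          rw [neg_mul, cexp_carlemanSymbol_mul, ← hτ]
          congr 4
          ring_nf
        · have : ¬ 3 * w ^ 2 ≤ 1 := by push Not at hwa ⊢; nlinarith
          rw [Set.indicator_of_mem (show w ∈ Set.Ioi 0 from hw),
            Set.indicator_of_notMem (fun h : w ∈ Set.Ioc 0 a => hwa h.2)]
          simp [carlemanMult, h.not_gt, this]
      · rw [Set.indicator_of_notMem (show w ∉ Set.Ioi 0 from hw),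
          Set.indicator_of_notMem (fun h : w ∈ Set.Ioc 0 a => hw h.1)]
    rw [e1, norm_neg, ← conj_integral_cexp (fun w => -x * w + m ^ 3 * w ^ 3), RCLike.norm_conj]
    refine norm_integral_cubic_phase_le le_rfl ha0.le hm hψ hψc ?_ (Or.inl ?_)
    · intro w hw
      refine ⟨(Real.exp_pos _).le, ?_⟩
      rw [Real.exp_le_one_iff]
      have : 3 * w ^ 2 ≤ 1 := by have := hw.1; have := hw.2; nlinarith
      nlinarith
    · intro w hw
      have h6 := mul_nonneg (neg_nonneg.2 h) hw.1
      have := mul_nonneg (Real.exp_pos (τ * (1 - 3 * w ^ 2))).le h6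
      linarith

open Complex in
theorem norm_integral_carlemanMult_le {τ : ℝ} (hτ : τ ≠ 0) (x : ℝ) :
    ‖∫ w, carlemanMult τ w * cexp (x * w * I)‖ ≤ 10 * |τ| ^ (-1 / 3 : ℝ) := by
  have h0 : 0 < |τ| := abs_pos.2 hτ
  have hm : 0 < |τ| ^ (1 / 3 : ℝ) := by positivity
  have hm3 : |τ| = (|τ| ^ (1 / 3 : ℝ)) ^ 3 := by
    rw [← Real.rpow_natCast, ← Real.rpow_mul h0.le]; norm_num
  have hInt : Integrable fun w : ℝ => carlemanMult τ w * cexp (x * w * I) := by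
    refine (integrable_carlemanMult τ).mul_bdd (c := 1) (by fun_prop)
      (Filter.Eventually.of_forall fun w => ?_)
    rw [← ofReal_mul, norm_exp_ofReal_mul_I]
  have B := norm_integral_Ioi_carlemanMult_le hm hm3 x
  have hneg : ∫ w in Set.Iic 0, carlemanMult τ w * cexp (x * w * I) =
      (starRingEnd ℂ) (∫ w in Set.Ioi 0, carlemanMult τ w * cexp (x * w * I)) := by
    rw [← integral_conj]
    have := integral_comp_neg_Ioi 0 (fun w : ℝ => carlemanMult τ w * cexp (x * w * I))
    rw [neg_zero] at this
    rw [← this]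
    congr 1
    ext w
    rw [carlemanMult_neg, map_mul, ← exp_conj]
    simp
  rw [← intervalIntegral.integral_Iic_add_Ioi hInt.integrableOn hInt.integrableOn (b := 0), hneg]
  calc _ ≤ 5 / |τ| ^ (1 / 3 : ℝ) + 5 / |τ| ^ (1 / 3 : ℝ) := by
        refine (norm_add_le _ _).trans (add_le_add ?_ B)
        rw [RCLike.norm_conj]; exact B
    _ = 10 * |τ| ^ (-1 / 3 : ℝ) := by
        rw [neg_div, Real.rpow_neg h0.le]; ring

open FourierTransform in
/-- Bessel's inequality for the Fourier integral on `L¹ ∩ L²`. -/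
theorem lintegral_enorm_fourier_sq_le {u : ℝ → ℂ} (h1 : Integrable u) (h2 : MemLp u 2) :
    ∫⁻ w, ‖𝓕 u w‖ₑ ^ 2 ≤ ∫⁻ x, ‖u x‖ₑ ^ 2 := by
  have cont : Continuous (𝓕 u) :=
    VectorFourier.fourierIntegral_continuous Real.continuous_fourierChar
      (by exact continuous_inner) h1
  have hae : ∀ᵐ w, 𝓕 u w = (𝓕 (h2.toLp u) : Lp ℂ 2 (volume : Measure ℝ)) w := by
    refine ae_eq_of_integral_contDiff_smul_eq cont.locallyIntegrable
      ((Lp.memLp _).locallyIntegrable (by norm_num)) fun g hg hgs => ?_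
    have hg₁ : HasCompactSupport (Complex.ofRealCLM ∘ g) := hgs.comp_left rfl
    have hg₂ := Complex.ofRealCLM.contDiff.comp hg
    let G := hg₁.toSchwartzMap hg₂
    have e := congrArg (fun T => T G) (Lp.fourier_toTemperedDistribution_eq (h2.toLp u))
    simp only [TemperedDistribution.fourier_apply, Lp.toTemperedDistribution_apply] at e
    have e2 : ∫ w, g w • (𝓕 (h2.toLp u) : Lp ℂ 2 (volume : Measure ℝ)) w = ∫ x, (𝓕 G) x • u x := by
      calc _ = ∫ w, G w • (𝓕 (h2.toLp u) : Lp ℂ 2 (volume : Measure ℝ)) w := by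
            congr 1
        _ = _ := by
            rw [← e]
            refine integral_congr_ae ?_
            filter_upwards [h2.coeFn_toLp] with x hx
            rw [hx]
    rw [e2]
    have := VectorFourier.integral_fourierIntegral_smul_eq_flip (L := innerₗ ℝ) (μ := volume)
      (ν := volume) Real.continuous_fourierChar continuous_inner (G.integrable (μ := volume)) h1
    rw [SchwartzMap.fourier_coe]
    refine Eq.trans ?_ (this.symm.trans ?_)
    · simp only [flip_innerₗ]
      rfl
    · rfl
  have e0 : ∀ g : ℝ → ℂ, ∫⁻ w, ‖g w‖ₑ ^ 2 = eLpNorm g 2 volume ^ 2 := fun g => by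
    have := eLpNorm_nnreal_pow_eq_lintegral (f := g) (μ := volume) (p := 2) two_ne_zero
    simpa using this.symm
  have e1 : ∫⁻ w, ‖𝓕 u w‖ₑ ^ 2 =
      eLpNorm (𝓕 (h2.toLp u) : Lp ℂ 2 (volume : Measure ℝ)) 2 volume ^ 2 := by
    rw [← eLpNorm_congr_ae hae, e0]
  have e2 : ∫⁻ w, ‖u w‖ₑ ^ 2 = eLpNorm (h2.toLp u : Lp ℂ 2 (volume : Measure ℝ)) 2 volume ^ 2 := by
    rw [eLpNorm_congr_ae h2.coeFn_toLp, e0]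
  have e3 := Lp.norm_fourier_eq (h2.toLp u)
  rw [e1, e2, ← ENNReal.ofReal_toReal (Lp.eLpNorm_ne_top (𝓕 (h2.toLp u))),
    ← ENNReal.ofReal_toReal (Lp.eLpNorm_ne_top (h2.toLp u)), ← Lp.norm_def, ← Lp.norm_def, e3]

/-- Marcinkiewicz interpolation between `L¹ → L^∞` and `L² → L²`, at the pair `(8/7, 8)`. -/
theorem lintegral_enorm_pow_eight_le {T : (ℝ → ℂ) → ℝ → ℂ} {A : ℝ} (hA : 0 < A) {f : ℝ → ℂ}
    (hfm : Measurable f) (hf : Integrable f) (hTf : AEMeasurable (T f))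
    (hT : ∀ s, MeasurableSet s → ∀ x, T f x = T (s.indicator f) x + T (sᶜ.indicator f) x)
    (h1 : ∀ s, MeasurableSet s → ∀ x, ‖T (s.indicator f) x‖ ≤ A * ∫ y in s, ‖f y‖)
    (h2 : ∀ s, MeasurableSet s → ∫⁻ x, ‖T (s.indicator f) x‖ₑ ^ 2 ≤ ∫⁻ y in s, ‖f y‖ₑ ^ 2)
    (hTm : ∀ s, MeasurableSet s → AEMeasurable (T (s.indicator f))) :
    ∫⁻ x, ‖T f x‖ₑ ^ 8 ≤ 2048 * ENNReal.ofReal A ^ 6 * (∫⁻ y, ‖f y‖ₑ ^ (8 / 7 : ℝ)) ^ 7 := by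
  set N := ∫⁻ y, ‖f y‖ₑ ^ (8 / 7 : ℝ) with hN
  have hA' : ENNReal.ofReal A ≠ 0 := by simpa using hA
  rcases eq_or_ne N ⊤ with hNt | hNt
  · rw [hNt, ENNReal.top_pow (by norm_num), ENNReal.mul_top (by positivity)]
    exact le_top
  rcases eq_or_ne N 0 with hN0 | hN0
  · rw [hN, lintegral_eq_zero_iff (by fun_prop)] at hN0
    have hf0 : ∫ y, ‖f y‖ = 0 := by
      rw [integral_eq_zero_iff_of_nonneg (fun _ => norm_nonneg _) hf.norm]
      filter_upwards [hN0] with y hy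
      simpa using hy
    have : ∀ x, T f x = 0 := fun x => by
      have := h1 Set.univ MeasurableSet.univ x
      rw [Set.indicator_univ, setIntegral_univ, hf0, mul_zero] at this
      simpa using this
    simp [this]
  set n := N.toReal with hn
  have hn0 : 0 < n := ENNReal.toReal_pos hN0 hNt
  have hNn : N = ENNReal.ofReal n := (ENNReal.ofReal_toReal hNt).symm
  have meas1 : Measurable (fun y => ‖f y‖ ^ (8 / 7 : ℝ)) := hfm.norm.pow_const _
  have hInt : Integrable (fun y => ‖f y‖ ^ (8 / 7 : ℝ)) := by
    refine ⟨meas1.aestronglyMeasurable, ?_⟩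
    rw [hasFiniteIntegral_iff_enorm]
    refine lt_of_eq_of_lt ?_ (lt_top_iff_ne_top.2 hNt)
    refine lintegral_congr fun y => ?_
    rw [Real.enorm_rpow_of_nonneg (norm_nonneg _) (by norm_num), enorm_norm]
  have hnI : ∫ y, ‖f y‖ ^ (8 / 7 : ℝ) = n := by
    rw [integral_eq_lintegral_of_nonneg_ae (Filter.Eventually.of_forall fun y => by positivity)
      meas1.aestronglyMeasurable, hn, hN]
    congr 1
    refine lintegral_congr fun y => ?_
    rw [← ENNReal.ofReal_rpow_of_nonneg (norm_nonneg _) (by norm_num), ofReal_norm]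
  let S : ℝ → Set ℝ := fun t => {y | t * ‖f y‖ ^ (1 / 7 : ℝ) ≤ A * n}
  have hS : ∀ t, MeasurableSet (S t) := fun t => measurableSet_le (by fun_prop) (by fun_prop)
  have large : ∀ t, 0 < t → ∀ x, ‖T ((S t)ᶜ.indicator f) x‖ ≤ t := by
    intro t ht x
    refine (h1 _ (hS t).compl x).trans ?_
    have : ∫ y in (S t)ᶜ, ‖f y‖ ≤ ∫ y in (S t)ᶜ, t / (A * n) * ‖f y‖ ^ (8 / 7 : ℝ) := by
      refine setIntegral_mono_on hf.norm.integrableOn (hInt.const_mul _).integrableOn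
        (hS t).compl fun y hy => ?_
      have hy' : A * n < t * ‖f y‖ ^ (1 / 7 : ℝ) := not_le.1 hy
      have e : ‖f y‖ ^ (8 / 7 : ℝ) = ‖f y‖ ^ (1 / 7 : ℝ) * ‖f y‖ := by
        rw [show (8 / 7 : ℝ) = 1 / 7 + 1 by norm_num,
          Real.rpow_add_of_nonneg (norm_nonneg _) (by norm_num) (by norm_num), Real.rpow_one]
      rw [e, ← mul_assoc]
      refine le_mul_of_one_le_left (norm_nonneg _) ?_
      rw [div_mul_eq_mul_div, one_le_div (by positivity)]
      exact hy'.le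
    calc A * ∫ y in (S t)ᶜ, ‖f y‖ ≤ A * (t / (A * n) * n) := by
          gcongr
          refine this.trans ?_
          rw [integral_const_mul, ← hnI]
          exact mul_le_mul_of_nonneg_left (setIntegral_le_integral hInt
            (Filter.Eventually.of_forall fun y => by positivity)) (by positivity)
      _ = t := by field_simp
  have level : ∀ t, 0 < t → volume {x | t < ‖T f x‖ / 2} ≤
      ENNReal.ofReal (t ^ 2)⁻¹ * ∫⁻ y in S t, ‖f y‖ₑ ^ 2 := by
    intro t ht
    have sub : {x | t < ‖T f x‖ / 2} ⊆
        {x | ENNReal.ofReal (t ^ 2) ≤ ‖T ((S t).indicator f) x‖ₑ ^ 2} := by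
      intro x hx
      have hx' : t < ‖T f x‖ / 2 := hx
      have l := large t ht x
      have nn := norm_add_le (T ((S t).indicator f) x) (T ((S t)ᶜ.indicator f) x)
      rw [← hT _ (hS t) x] at nn
      have : t ≤ ‖T ((S t).indicator f) x‖ := by linarith
      change ENNReal.ofReal (t ^ 2) ≤ _
      rw [ENNReal.ofReal_pow ht.le, ← ofReal_norm]
      gcongr
    refine (measure_mono sub).trans ?_
    have ch := mul_meas_ge_le_lintegral₀ ((hTm _ (hS t)).enorm.pow_const 2) (ENNReal.ofReal (t ^ 2))
    have ht2 : ENNReal.ofReal (t ^ 2) ≠ 0 := by simpa using ht.ne'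
    rw [ENNReal.ofReal_inv_of_pos (by positivity), ← ENNReal.div_eq_inv_mul,
      ENNReal.le_div_iff_mul_le (Or.inl ht2) (Or.inl ENNReal.ofReal_ne_top), mul_comm]
    exact ch.trans (h2 _ (hS t))
  have lc := lintegral_rpow_eq_lintegral_meas_lt_mul volume (f := fun x => ‖T f x‖ / 2)
    (Filter.Eventually.of_forall fun x => by positivity) (by fun_prop) (p := 8) (by norm_num)
  have e0 : ∫⁻ x, ‖T f x‖ₑ ^ 8 = 256 * ∫⁻ x, ENNReal.ofReal ((‖T f x‖ / 2) ^ (8 : ℝ)) := by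
    rw [← lintegral_const_mul' _ _ (by norm_num)]
    refine lintegral_congr fun x => ?_
    rw [show (256 : ENNReal) = ENNReal.ofReal 256 by norm_num, ← ENNReal.ofReal_mul (by norm_num),
      ← ofReal_norm, ← ENNReal.ofReal_pow (norm_nonneg _)]
    congr 1
    rw [show (8 : ℝ) = ((8 : ℕ) : ℝ) by norm_num, Real.rpow_natCast]
    ring
  have inner : ∀ y,
      ∫⁻ t in Set.Ioi (0 : ℝ), ENNReal.ofReal (t ^ 5) * (S t).indicator (fun y => ‖f y‖ₑ ^ 2) y
      ≤ ENNReal.ofReal (A * n) ^ 6 * ‖f y‖ₑ ^ (8 / 7 : ℝ) := by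
    intro y
    rcases eq_or_ne (f y) 0 with hy | hy
    · have : ∀ t, (S t).indicator (fun y => ‖f y‖ₑ ^ 2) y = 0 := fun t => by
        by_cases h : y ∈ S t
        · rw [Set.indicator_of_mem h, hy, enorm_zero, zero_pow two_ne_zero]
        · rw [Set.indicator_of_notMem h]
      simp only [this, mul_zero, lintegral_zero]
      exact zero_le
    have hy0 : 0 < ‖f y‖ := norm_pos_iff.2 hy
    set v := ‖f y‖ ^ (1 / 7 : ℝ) with hv
    have hv0 : 0 < v := by positivity
    set r := A * n / v with hr
    have hr0 : 0 < r := by positivity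
    have hv7 : ‖f y‖ = v ^ 7 := by
      rw [hv, ← Real.rpow_natCast, ← Real.rpow_mul hy0.le]; norm_num
    have hv8 : ‖f y‖ ^ (8 / 7 : ℝ) = v ^ 8 := by
      rw [hv, ← Real.rpow_natCast, ← Real.rpow_mul hy0.le]; norm_num
    calc _ ≤ ∫⁻ t in Set.Ioi (0 : ℝ), (Set.Ioc 0 r).indicator
            (fun _ => ENNReal.ofReal (r ^ 5) * ‖f y‖ₑ ^ 2) t := by
          refine setLIntegral_mono (measurable_const.indicator measurableSet_Ioc) fun t ht => ?_
          have ht0 : 0 < t := ht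
          by_cases h : y ∈ S t
          · have htr : t ≤ r := by
              rw [hr, le_div_iff₀ hv0]; exact h
            rw [Set.indicator_of_mem h, Set.indicator_of_mem (show t ∈ Set.Ioc 0 r from ⟨ht0, htr⟩)]
            gcongr
          · rw [Set.indicator_of_notMem h, mul_zero]; exact zero_le
      _ ≤ ∫⁻ t, (Set.Ioc 0 r).indicator
            (fun _ => ENNReal.ofReal (r ^ 5) * ‖f y‖ₑ ^ 2) t := setLIntegral_le_lintegral _ _
      _ = ENNReal.ofReal (r ^ 5) * ‖f y‖ₑ ^ 2 * ENNReal.ofReal r := by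
          rw [lintegral_indicator_const measurableSet_Ioc, Real.volume_Ioc, sub_zero]
      _ = _ := by
          rw [← ofReal_norm, ENNReal.ofReal_rpow_of_nonneg (norm_nonneg _) (by norm_num), hv8, hv7,
            ← ENNReal.ofReal_pow (by positivity), ← ENNReal.ofReal_pow (by positivity),
            ← ENNReal.ofReal_mul (by positivity), ← ENNReal.ofReal_mul (by positivity),
            ← ENNReal.ofReal_mul (by positivity)]
          congr 1
          rw [hr]
          field_simp
  have meas2 : Measurable (Function.uncurry fun (t : ℝ) (y : ℝ) =>
      ENNReal.ofReal (t ^ 5) * (S t).indicator (fun y => ‖f y‖ₑ ^ 2) y) := by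
    have : MeasurableSet {p : ℝ × ℝ | p.1 * ‖f p.2‖ ^ (1 / 7 : ℝ) ≤ A * n} :=
      measurableSet_le (by fun_prop) (by fun_prop)
    refine Measurable.mul (by fun_prop) ?_
    exact (by fun_prop : Measurable fun p : ℝ × ℝ => ‖f p.2‖ₑ ^ 2).indicator this
  calc ∫⁻ x, ‖T f x‖ₑ ^ 8
      = 256 * (8 * ∫⁻ t in Set.Ioi (0 : ℝ), volume {x | t < ‖T f x‖ / 2} *
          ENNReal.ofReal (t ^ (8 - 1 : ℝ))) := by
        rw [e0, lc]; norm_num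
    _ ≤ 256 * (8 * ∫⁻ t in Set.Ioi (0 : ℝ), ∫⁻ y, ENNReal.ofReal (t ^ 5) *
          (S t).indicator (fun y => ‖f y‖ₑ ^ 2) y) := by
        gcongr 256 * (8 * ?_)
        refine setLIntegral_mono meas2.lintegral_prod_right' fun t ht => ?_
        have ht0 : 0 < t := ht
        rw [lintegral_const_mul' _ _ ENNReal.ofReal_ne_top, lintegral_indicator (hS t)]
        refine (mul_le_mul_left (level t ht0) _).trans (le_of_eq ?_)
        rw [mul_right_comm, ← ENNReal.ofReal_mul (by positivity)]
        congr 2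
        rw [show (8 - 1 : ℝ) = ((7 : ℕ) : ℝ) by norm_num, Real.rpow_natCast]
        field_simp
    _ = 256 * (8 * ∫⁻ y, ∫⁻ t in Set.Ioi (0 : ℝ), ENNReal.ofReal (t ^ 5) *
          (S t).indicator (fun y => ‖f y‖ₑ ^ 2) y) := by
        rw [lintegral_lintegral_swap meas2.aemeasurable]
    _ ≤ 256 * (8 * ∫⁻ y, ENNReal.ofReal (A * n) ^ 6 * ‖f y‖ₑ ^ (8 / 7 : ℝ)) := by
        gcongr with y
        exact inner y
    _ = 2048 * ENNReal.ofReal A ^ 6 * N ^ 7 := by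
        rw [lintegral_const_mul' _ _ (by finiteness), ← hN, ENNReal.ofReal_mul hA.le, ← hNn]
        ring

theorem lintegral_comp_abs_le {φ : ℝ → ENNReal} (hφ : Measurable φ) :
    ∫⁻ z, φ |z| ≤ 2 * ∫⁻ z in Set.Ioi (0 : ℝ), φ z := by
  have hm : Measurable ((Set.Ici (0 : ℝ)).indicator φ) := hφ.indicator measurableSet_Ici
  have hneg : ∫⁻ z, (Set.Ici (0 : ℝ)).indicator φ (-z) = ∫⁻ z, (Set.Ici (0 : ℝ)).indicator φ z :=
    lintegral_neg_eq_self (μ := volume) _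
  calc ∫⁻ z, φ |z|
      ≤ ∫⁻ z, ((Set.Ici (0 : ℝ)).indicator φ z + (Set.Ici (0 : ℝ)).indicator φ (-z)) := by
        refine lintegral_mono fun z => ?_
        rcases le_total 0 z with h | h
        · rw [abs_of_nonneg h, Set.indicator_of_mem (show z ∈ Set.Ici 0 from h)]
          exact le_self_add
        · rw [abs_of_nonpos h, Set.indicator_of_mem (show -z ∈ Set.Ici 0 from neg_nonneg.2 h)]
          exact le_add_self
    _ = 2 * ∫⁻ z in Set.Ioi (0 : ℝ), φ z := by
        rw [lintegral_add_left hm, hneg, lintegral_indicator measurableSet_Ici,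
          setLIntegral_congr Ioi_ae_eq_Ici.symm, two_mul]

theorem lintegral_indicator_le_rpow {R : ℝ} (hR : 0 < R) :
    ∫⁻ z : ℝ, (Set.Iic R).indicator (fun r => ENNReal.ofReal (r ^ (-1 / 4 : ℝ))) |z| ≤
      ENNReal.ofReal (3 * R ^ (3 / 4 : ℝ)) := by
  have hm : Measurable ((Set.Iic R).indicator (fun r : ℝ => ENNReal.ofReal (r ^ (-1 / 4 : ℝ)))) :=
    (Measurable.ennreal_ofReal (measurable_id.pow_const _)).indicator measurableSet_Iic
  refine (lintegral_comp_abs_le hm).trans ?_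
  have h1 : IntervalIntegrable (fun r : ℝ => r ^ (-1 / 4 : ℝ)) volume 0 R :=
    intervalIntegral.intervalIntegrable_rpow' (by norm_num)
  rw [intervalIntegrable_iff_integrableOn_Ioc_of_le hR.le] at h1
  rw [lintegral_indicator measurableSet_Iic, Measure.restrict_restrict measurableSet_Iic,
    Set.inter_comm, Set.Ioi_inter_Iic, ← ofReal_integral_eq_lintegral_ofReal h1,
    ← intervalIntegral.integral_of_le hR.le, integral_rpow (Or.inl (by norm_num))]
  · rw [show (2 : ENNReal) = ENNReal.ofReal 2 by norm_num, ← ENNReal.ofReal_mul (by norm_num)]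
    apply ENNReal.ofReal_le_ofReal
    rw [Real.zero_rpow (by norm_num), show (-1 / 4 + 1 : ℝ) = 3 / 4 by norm_num]
    have : 0 ≤ R ^ (3 / 4 : ℝ) := by positivity
    linarith
  · filter_upwards [ae_restrict_mem measurableSet_Ioc] with r hr
    have := hr.1
    positivity

theorem lintegral_indicator_gt_rpow {R : ℝ} (hR : 0 < R) :
    ∫⁻ z : ℝ, ((Set.Ioi R).indicator (fun r => ENNReal.ofReal (r ^ (-1 / 4 : ℝ))) |z|) ^ (8 : ℝ) ≤
      ENNReal.ofReal (2 * R⁻¹) := by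
  have hm : Measurable ((Set.Ioi R).indicator (fun r : ℝ => ENNReal.ofReal (r ^ (-1 / 4 : ℝ)))) :=
    (Measurable.ennreal_ofReal (measurable_id.pow_const _)).indicator measurableSet_Ioi
  refine (lintegral_comp_abs_le (hm.pow_const (8 : ℝ))).trans ?_
  have h1 : IntegrableOn (fun r : ℝ => r ^ (-2 : ℝ)) (Set.Ioi R) :=
    integrableOn_Ioi_rpow_of_lt (by norm_num) hR
  have e : ∀ r, ((Set.Ioi R).indicator (fun r => ENNReal.ofReal (r ^ (-1 / 4 : ℝ))) r) ^ (8 : ℝ) =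
      (Set.Ioi R).indicator (fun r => ENNReal.ofReal (r ^ (-2 : ℝ))) r := by
    intro r
    by_cases h : r ∈ Set.Ioi R
    · have hr : 0 < r := hR.trans h
      rw [Set.indicator_of_mem h, Set.indicator_of_mem h,
        ENNReal.ofReal_rpow_of_nonneg (by positivity) (by norm_num), ← Real.rpow_mul hr.le]
      norm_num
    · rw [Set.indicator_of_notMem h, Set.indicator_of_notMem h,
        ENNReal.zero_rpow_of_pos (by norm_num)]
  simp_rw [e]
  rw [lintegral_indicator measurableSet_Ioi, Measure.restrict_restrict measurableSet_Ioi,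
    Set.Ioi_inter_Ioi, max_eq_left hR.le, ← ofReal_integral_eq_lintegral_ofReal h1,
    integral_Ioi_rpow_of_lt (by norm_num) hR]
  · rw [show (2 : ENNReal) = ENNReal.ofReal 2 by norm_num, ← ENNReal.ofReal_mul (by norm_num)]
    apply ENNReal.ofReal_le_ofReal
    norm_num
    rw [Real.rpow_neg_one]
  · filter_upwards [ae_restrict_mem measurableSet_Ioi] with r hr
    have : 0 < r := hR.trans hr
    positivity

theorem lintegral_min_mul_rpow_le {g : ℝ → ENNReal} (hg : Measurable g)
    (hg1 : ∫⁻ y, g y ^ (8 / 7 : ℝ) ≤ 1) (a : ENNReal) (x : ℝ) :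
    ∫⁻ y, min (g y) a * ENNReal.ofReal (|x - y| ^ (-1 / 4 : ℝ)) ≤ 5 * a ^ (1 / 7 : ℝ) := by
  rcases eq_or_ne a 0 with ha | ha
  · simp [ha]
  rcases eq_or_ne a ⊤ with hat | hat
  · rw [hat, ENNReal.top_rpow_of_pos (by norm_num), ENNReal.mul_top (by norm_num)]
    exact le_top
  obtain ⟨α, hα, rfl⟩ : ∃ α : ℝ, 0 < α ∧ a = ENNReal.ofReal α :=
    ⟨a.toReal, ENNReal.toReal_pos ha hat, (ENNReal.ofReal_toReal hat).symm⟩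
  set R := α ^ (-8 / 7 : ℝ) with hR
  have hR0 : 0 < R := by positivity
  set k : ℝ → ENNReal := fun r => ENNReal.ofReal (r ^ (-1 / 4 : ℝ)) with hk
  have mk : Measurable k := Measurable.ennreal_ofReal (measurable_id.pow_const _)
  have m1 : Measurable ((Set.Iic R).indicator k) := mk.indicator measurableSet_Iic
  have m2 : Measurable ((Set.Ioi R).indicator k) := mk.indicator measurableSet_Ioi
  have mabs : Measurable fun y : ℝ => |x - y| := by fun_prop
  have m1' : Measurable fun y => ENNReal.ofReal α * (Set.Iic R).indicator k |x - y| :=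
    (m1.comp mabs).const_mul _
  have m2' : Measurable fun y => (Set.Ioi R).indicator k |x - y| := m2.comp mabs
  calc ∫⁻ y, min (g y) (ENNReal.ofReal α) * k |x - y|
      ≤ ∫⁻ y, (ENNReal.ofReal α * (Set.Iic R).indicator k |x - y| +
          g y * (Set.Ioi R).indicator k |x - y|) := by
        refine lintegral_mono fun y => ?_
        rcases le_or_gt |x - y| R with h | h
        · rw [Set.indicator_of_mem (show |x - y| ∈ Set.Iic R from h)]
          exact le_trans (mul_le_mul_left (min_le_right _ _) _) le_self_add
        · rw [Set.indicator_of_mem (show |x - y| ∈ Set.Ioi R from h)]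
          exact le_trans (mul_le_mul_left (min_le_left _ _) _) le_add_self
    _ = ENNReal.ofReal α * (∫⁻ y, (Set.Iic R).indicator k |x - y|) +
          ∫⁻ y, (g * fun y => (Set.Ioi R).indicator k |x - y|) y := by
        rw [lintegral_add_left m1',
          lintegral_const_mul' _ _ ENNReal.ofReal_ne_top]
        rfl
    _ ≤ ENNReal.ofReal α * ENNReal.ofReal (3 * R ^ (3 / 4 : ℝ)) +
          1 ^ (1 / (8 / 7) : ℝ) * ENNReal.ofReal (2 * R⁻¹) ^ (1 / 8 : ℝ) := by
        gcongr
        · rw [lintegral_sub_left_eq_self (fun z => (Set.Iic R).indicator k |z|) x]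
          exact lintegral_indicator_le_rpow hR0
        · refine (ENNReal.lintegral_mul_le_Lp_mul_Lq volume (p := 8 / 7) (q := 8)
            (by constructor <;> norm_num) hg.aemeasurable m2'.aemeasurable).trans ?_
          gcongr
          rw [lintegral_sub_left_eq_self (fun z => ((Set.Ioi R).indicator k |z|) ^ (8 : ℝ)) x]
          exact lintegral_indicator_gt_rpow hR0
    _ ≤ 5 * ENNReal.ofReal α ^ (1 / 7 : ℝ) := by
        rw [ENNReal.one_rpow, one_mul, ENNReal.ofReal_rpow_of_nonneg (by positivity) (by norm_num),
          ENNReal.ofReal_rpow_of_nonneg hα.le (by norm_num), ← ENNReal.ofReal_mul hα.le,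
          ← ENNReal.ofReal_add (by positivity) (by positivity),
          show (5 : ENNReal) = ENNReal.ofReal 5 by norm_num, ← ENNReal.ofReal_mul (by norm_num)]
        apply ENNReal.ofReal_le_ofReal
        have e1 : α * R ^ (3 / 4 : ℝ) = α ^ (1 / 7 : ℝ) := by
          rw [hR, ← Real.rpow_mul hα.le]
          nth_rw 1 [← Real.rpow_one α]
          rw [← Real.rpow_add hα]; norm_num
        have e2 : R⁻¹ ^ (1 / 8 : ℝ) = α ^ (1 / 7 : ℝ) := by
          rw [hR, ← Real.rpow_neg hα.le, ← Real.rpow_mul hα.le]; norm_num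
        have e3 : (2 : ℝ) ^ (1 / 8 : ℝ) ≤ 2 := by
          calc (2 : ℝ) ^ (1 / 8 : ℝ) ≤ 2 ^ (1 : ℝ) :=
                Real.rpow_le_rpow_of_exponent_le (by norm_num) (by norm_num)
            _ = 2 := Real.rpow_one 2
        rw [Real.mul_rpow (by norm_num) (by positivity), e2]
        have : 0 ≤ α ^ (1 / 7 : ℝ) := by positivity
        nlinarith

theorem lintegral_lintegral_rpow_le_of_le_one {f g : ℝ → ENNReal} (hf : Measurable f)
    (hg : Measurable g) (hf1 : ∫⁻ y, f y ^ (8 / 7 : ℝ) ≤ 1) (hg1 : ∫⁻ y, g y ^ (8 / 7 : ℝ) ≤ 1) :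
    ∫⁻ x, ∫⁻ y, f x * g y * ENNReal.ofReal (|x - y| ^ (-1 / 4 : ℝ)) ≤ 10 := by
  have mk : Measurable fun p : ℝ × ℝ => ENNReal.ofReal (|p.1 - p.2| ^ (-1 / 4 : ℝ)) :=
    Measurable.ennreal_ofReal (Measurable.pow_const (by fun_prop) _)
  have half : ∀ {f g : ℝ → ENNReal}, Measurable f → Measurable g →
      ∫⁻ y, f y ^ (8 / 7 : ℝ) ≤ 1 → ∫⁻ y, g y ^ (8 / 7 : ℝ) ≤ 1 →
      ∫⁻ x, ∫⁻ y, f x * (min (g y) (f x) * ENNReal.ofReal (|x - y| ^ (-1 / 4 : ℝ))) ≤ 5 := by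
    intro f g hf hg hf1 hg1
    calc _ ≤ ∫⁻ x, 5 * f x ^ (8 / 7 : ℝ) := by
          refine lintegral_mono fun x => ?_
          have mkx : Measurable fun y : ℝ => ENNReal.ofReal (|x - y| ^ (-1 / 4 : ℝ)) :=
            mk.comp (by fun_prop : Measurable fun y : ℝ => (x, y))
          have mgx : Measurable fun y : ℝ =>
              min (g y) (f x) * ENNReal.ofReal (|x - y| ^ (-1 / 4 : ℝ)) :=
            (hg.min measurable_const).mul mkx
          rw [lintegral_const_mul _ mgx]
          refine (mul_le_mul_right (lintegral_min_mul_rpow_le hg hg1 (f x) x) _).trans ?_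
          rw [show (8 / 7 : ℝ) = 1 + 1 / 7 by norm_num,
            ENNReal.rpow_add_of_nonneg _ _ (by norm_num) (by norm_num), ENNReal.rpow_one,
            mul_left_comm]
      _ ≤ 5 := by
          rw [lintegral_const_mul _ (hf.pow_const _)]
          exact mul_le_of_le_one_right' hf1
  have m1 : Measurable (fun p : ℝ × ℝ =>
      f p.1 * (min (g p.2) (f p.1) * ENNReal.ofReal (|p.1 - p.2| ^ (-1 / 4 : ℝ)))) :=
    (by fun_prop : Measurable fun p : ℝ × ℝ => f p.1).mul
      (((hg.comp measurable_snd).min (hf.comp measurable_fst)).mul mk)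
  have m2 : Measurable (fun p : ℝ × ℝ =>
      g p.2 * (min (f p.1) (g p.2) * ENNReal.ofReal (|p.1 - p.2| ^ (-1 / 4 : ℝ)))) :=
    (by fun_prop : Measurable fun p : ℝ × ℝ => g p.2).mul
      (((hf.comp measurable_fst).min (hg.comp measurable_snd)).mul mk)
  calc _ ≤ ∫⁻ x, ∫⁻ y, (f x * (min (g y) (f x) * ENNReal.ofReal (|x - y| ^ (-1 / 4 : ℝ))) +
          g y * (min (f x) (g y) * ENNReal.ofReal (|x - y| ^ (-1 / 4 : ℝ)))) := by
        refine lintegral_mono fun x => lintegral_mono fun y => ?_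
        rcases le_total (g y) (f x) with h | h
        · rw [min_eq_left h, ← mul_assoc]; exact le_self_add
        · rw [min_eq_left h]; exact le_trans (le_of_eq (by ring)) le_add_self
    _ = (∫⁻ x, ∫⁻ y, f x * (min (g y) (f x) * ENNReal.ofReal (|x - y| ^ (-1 / 4 : ℝ)))) +
          ∫⁻ x, ∫⁻ y, g y * (min (f x) (g y) * ENNReal.ofReal (|x - y| ^ (-1 / 4 : ℝ))) := by
        rw [← lintegral_add_left m1.lintegral_prod_right']
        refine lintegral_congr fun x => ?_
        have m1x : Measurable fun y =>
            f x * (min (g y) (f x) * ENNReal.ofReal (|x - y| ^ (-1 / 4 : ℝ))) :=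
          m1.comp measurable_prodMk_left
        rw [lintegral_add_left m1x]
    _ ≤ 5 + 5 := by
        refine add_le_add (half hf hg hf1 hg1) ?_
        rw [lintegral_lintegral_swap m2.aemeasurable]
        refine le_trans (le_of_eq ?_) (half hg hf hg1 hf1)
        refine lintegral_congr fun y => lintegral_congr fun x => ?_
        rw [abs_sub_comm]
    _ = 10 := by norm_num

/-- The diagonal Hardy–Littlewood–Sobolev inequality on the line with kernel `|x - y|^(-1/4)`. -/
theorem lintegral_lintegral_rpow_le {f g : ℝ → ENNReal} (hf : Measurable f) (hg : Measurable g) :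
    ∫⁻ x, ∫⁻ y, f x * g y * ENNReal.ofReal (|x - y| ^ (-1 / 4 : ℝ)) ≤
      10 * (∫⁻ y, f y ^ (8 / 7 : ℝ)) ^ (7 / 8 : ℝ) * (∫⁻ y, g y ^ (8 / 7 : ℝ)) ^ (7 / 8 : ℝ) := by
  set F := (∫⁻ y, f y ^ (8 / 7 : ℝ)) ^ (7 / 8 : ℝ) with hF
  set G := (∫⁻ y, g y ^ (8 / 7 : ℝ)) ^ (7 / 8 : ℝ) with hG
  have zero : ∀ {f : ℝ → ENNReal}, Measurable f →
      (∫⁻ y, f y ^ (8 / 7 : ℝ)) ^ (7 / 8 : ℝ) = 0 → ∀ᵐ y, f y = 0 := by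
    intro f hf h
    rw [ENNReal.rpow_eq_zero_iff_of_pos (by norm_num), lintegral_eq_zero_iff (hf.pow_const _)] at h
    filter_upwards [h] with y hy
    rwa [Pi.zero_apply, ENNReal.rpow_eq_zero_iff_of_pos (by norm_num)] at hy
  rcases eq_or_ne F 0 with hF0 | hF0
  · refine le_of_eq_of_le ?_ zero_le
    rw [lintegral_congr_ae (g := fun _ => 0), lintegral_zero]
    filter_upwards [zero hf hF0] with x hx
    simp [hx]
  rcases eq_or_ne G 0 with hG0 | hG0
  · refine le_of_eq_of_le ?_ zero_le
    rw [lintegral_congr (g := fun _ => 0), lintegral_zero]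
    intro x
    rw [lintegral_congr_ae (g := fun _ => 0), lintegral_zero]
    filter_upwards [zero hg hG0] with y hy
    simp [hy]
  rcases eq_or_ne F ⊤ with hFt | hFt
  · rw [hFt, ENNReal.mul_top (by norm_num), ENNReal.top_mul hG0]; exact le_top
  rcases eq_or_ne G ⊤ with hGt | hGt
  · rw [hGt, ENNReal.mul_top (mul_ne_zero (by norm_num) hF0)]; exact le_top
  have normed : ∀ {f : ℝ → ENNReal} {F : ENNReal}, Measurable f → F ≠ 0 → F ≠ ⊤ →
      F = (∫⁻ y, f y ^ (8 / 7 : ℝ)) ^ (7 / 8 : ℝ) →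
      ∫⁻ y, (F⁻¹ * f y) ^ (8 / 7 : ℝ) ≤ 1 := by
    intro f F hf h0 ht h
    have e : F ^ (8 / 7 : ℝ) = ∫⁻ y, f y ^ (8 / 7 : ℝ) := by
      rw [h, ← ENNReal.rpow_mul]; norm_num
    simp_rw [ENNReal.mul_rpow_of_nonneg _ _ (show (0 : ℝ) ≤ 8 / 7 by norm_num)]
    rw [lintegral_const_mul _ (hf.pow_const _), ← e,
      ← ENNReal.mul_rpow_of_nonneg _ _ (by norm_num), ENNReal.inv_mul_cancel h0 ht,
      ENNReal.one_rpow]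
  have key := lintegral_lintegral_rpow_le_of_le_one (hf.const_mul F⁻¹) (hg.const_mul G⁻¹)
    (normed hf hF0 hFt hF) (normed hg hG0 hGt hG)
  calc _ = ∫⁻ x, ∫⁻ y, F * G * (F⁻¹ * f x * (G⁻¹ * g y) *
          ENNReal.ofReal (|x - y| ^ (-1 / 4 : ℝ))) := by
        refine lintegral_congr fun x => lintegral_congr fun y => ?_
        calc _ = (F * F⁻¹) * (G * G⁻¹) * (f x * g y * ENNReal.ofReal (|x - y| ^ (-1 / 4 : ℝ))) := by
              rw [ENNReal.mul_inv_cancel hF0 hFt, ENNReal.mul_inv_cancel hG0 hGt, one_mul, one_mul]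
          _ = _ := by ring
    _ = F * G * ∫⁻ x, ∫⁻ y, (F⁻¹ * f x * (G⁻¹ * g y) *
          ENNReal.ofReal (|x - y| ^ (-1 / 4 : ℝ))) := by
        simp_rw [lintegral_const_mul' _ _ (ENNReal.mul_ne_top hFt hGt)]
    _ ≤ F * G * 10 := by gcongr
    _ = 10 * F * G := by ring

open FourierTransform Real in
/-- The solution operator, at time lag `τ`, of `∂ₜ + ∂ₓ³ - 3 ∂ₓ² - 1` on the line. -/
noncomputable def carlemanProp (τ : ℝ) (f : ℝ → ℂ) : ℝ → ℂ :=
  𝓕⁻ fun ξ => carlemanMult τ (2 * π * ξ) * 𝓕 f ξ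

open Real in
theorem integrable_carlemanMult_two_pi (τ : ℝ) :
    Integrable fun ξ => carlemanMult τ (2 * π * ξ) :=
  (integrable_carlemanMult τ).comp_mul_left' (by positivity)

open FourierTransform in
theorem continuous_fourier {f : ℝ → ℂ} (hf : Integrable f) : Continuous (𝓕 f) :=
  VectorFourier.fourierIntegral_continuous Real.continuous_fourierChar
    (by exact continuous_inner) hf

open FourierTransform in
theorem norm_fourier_le (f : ℝ → ℂ) (ξ : ℝ) : ‖𝓕 f ξ‖ ≤ ∫ y, ‖f y‖ :=
  VectorFourier.norm_fourierIntegral_le_integral_norm _ _ _ _ _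

open FourierTransform Real in
theorem integrable_carlemanMult_mul_fourier (τ : ℝ) {f : ℝ → ℂ} (hf : Integrable f) :
    Integrable fun ξ => carlemanMult τ (2 * π * ξ) * 𝓕 f ξ :=
  (integrable_carlemanMult_two_pi τ).mul_bdd
    (continuous_fourier hf).aestronglyMeasurable (Filter.Eventually.of_forall (norm_fourier_le f))

open FourierTransform Real in
theorem continuous_carlemanProp (τ : ℝ) {f : ℝ → ℂ} (hf : Integrable f) :
    Continuous (carlemanProp τ f) := by
  unfold carlemanProp
  rw [fourierInv_eq_fourier_comp_neg]
  exact continuous_fourier (integrable_carlemanMult_mul_fourier τ hf).comp_neg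

open FourierTransform Real in
theorem carlemanProp_add (τ : ℝ) {f g : ℝ → ℂ} (hf : Integrable f) (hg : Integrable g) (x : ℝ) :
    carlemanProp τ (f + g) x = carlemanProp τ f x + carlemanProp τ g x := by
  have e : 𝓕 (f + g) = 𝓕 f + 𝓕 g :=
    VectorFourier.fourierIntegral_add Real.continuous_fourierChar (by exact continuous_inner) hf hg
  unfold carlemanProp
  rw [fourierInv_eq_fourier_neg, fourierInv_eq_fourier_neg, fourierInv_eq_fourier_neg, e]
  have := VectorFourier.fourierIntegral_add (L := innerₗ ℝ) Real.continuous_fourierChar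
    (by exact continuous_inner) (integrable_carlemanMult_mul_fourier τ hf)
    (integrable_carlemanMult_mul_fourier τ hg)
  simp only [Pi.add_apply, mul_add]
  exact congrFun this (-x)

open FourierTransform Real in
theorem lintegral_enorm_carlemanProp_sq_le (τ : ℝ) {f : ℝ → ℂ} (hf : Integrable f)
    (hf2 : MemLp f 2) : ∫⁻ x, ‖carlemanProp τ f x‖ₑ ^ 2 ≤ ∫⁻ x, ‖f x‖ₑ ^ 2 := by
  set v := fun ξ => carlemanMult τ (2 * π * ξ) * 𝓕 f ξ with hv
  have hv1 : Integrable v := integrable_carlemanMult_mul_fourier τ hf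
  have le : ∀ ξ, ‖v ξ‖ₑ ≤ ‖𝓕 f ξ‖ₑ := fun ξ => by
    rw [hv, enorm_mul]
    refine mul_le_of_le_one_left' ?_
    rw [← ofReal_norm, ← ENNReal.ofReal_one]
    exact ENNReal.ofReal_le_ofReal (norm_carlemanMult_le_one _ _)
  have e : ∀ g : ℝ → ℂ, ∫⁻ w, ‖g w‖ₑ ^ 2 = eLpNorm g 2 volume ^ 2 := fun g => by
    have := eLpNorm_nnreal_pow_eq_lintegral (f := g) (μ := volume) (p := 2) two_ne_zero
    simpa using this.symm
  have le2 : ∫⁻ ξ, ‖v ξ‖ₑ ^ 2 ≤ ∫⁻ x, ‖f x‖ₑ ^ 2 := by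
    refine le_trans (lintegral_mono fun ξ => ?_) (lintegral_enorm_fourier_sq_le hf hf2)
    exact pow_le_pow_left₀ zero_le (le ξ) 2
  have hv2 : MemLp v 2 := by
    refine ⟨hv1.aestronglyMeasurable, ?_⟩
    rw [e, e] at le2
    exact (ENNReal.pow_lt_top_iff.1 (le2.trans_lt (ENNReal.pow_lt_top hf2.2))).resolve_right
      two_ne_zero
  calc ∫⁻ x, ‖carlemanProp τ f x‖ₑ ^ 2 = ∫⁻ x, ‖𝓕 v (-x)‖ₑ ^ 2 := by
        simp only [carlemanProp, fourierInv_eq_fourier_neg, hv]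
    _ = ∫⁻ x, ‖𝓕 v x‖ₑ ^ 2 := lintegral_neg_eq_self (μ := volume) fun x => ‖𝓕 v x‖ₑ ^ 2
    _ ≤ _ := (lintegral_enorm_fourier_sq_le hv1 hv2).trans le2

open FourierTransform Real Complex in
theorem norm_carlemanProp_le {τ : ℝ} (hτ : τ ≠ 0) {f : ℝ → ℂ} (hf : Integrable f) (x : ℝ) :
    ‖carlemanProp τ f x‖ ≤ 10 * |τ| ^ (-1 / 3 : ℝ) * ∫ y, ‖f y‖ := by
  set g : ℝ → ℂ := fun ξ => cexp (2 * π * ξ * x * I) * carlemanMult τ (2 * π * ξ) with hg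
  have hgi : Integrable g := by
    refine (integrable_carlemanMult_two_pi τ).bdd_mul (c := 1) (by fun_prop)
      (Filter.Eventually.of_forall fun ξ => le_of_eq ?_)
    rw [show (2 * π * ξ * x * I : ℂ) = (2 * π * ξ * x : ℝ) * I by push_cast; ring,
      norm_exp_ofReal_mul_I]
  have flip : ∫ ξ, 𝓕 f ξ • g ξ = ∫ y, f y • 𝓕 g y := by
    have := VectorFourier.integral_fourierIntegral_smul_eq_flip (L := innerₗ ℝ) (μ := volume)
      (ν := volume) Real.continuous_fourierChar continuous_inner hf hgi
    rw [flip_innerₗ] at this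
    exact this
  have kernel : ∀ y, ‖𝓕 g y‖ ≤ 10 * |τ| ^ (-1 / 3 : ℝ) := by
    intro y
    have e : 𝓕 g y = ∫ ξ, (fun w : ℝ => carlemanMult τ w * cexp (((x - y : ℝ) : ℂ) * w * I))
        (2 * π * ξ) := by
      rw [Real.fourier_real_eq_integral_exp_smul]
      refine integral_congr_ae (Filter.Eventually.of_forall fun ξ => ?_)
      simp only [hg, smul_eq_mul]
      rw [← mul_assoc, ← Complex.exp_add, mul_comm]
      congr 2
      push_cast
      ring
    rw [e, Measure.integral_comp_mul_left
      (fun w : ℝ => carlemanMult τ w * cexp (((x - y : ℝ) : ℂ) * w * I)) (2 * π), norm_smul]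
    refine le_trans (mul_le_of_le_one_left (norm_nonneg _) ?_)
      (norm_integral_carlemanMult_le hτ (x - y))
    rw [norm_eq_abs, abs_abs, abs_of_pos (by positivity)]
    refine inv_le_one_of_one_le₀ ?_
    linarith [Real.pi_gt_three]
  have e : carlemanProp τ f x = ∫ ξ, 𝓕 f ξ • g ξ := by
    unfold carlemanProp
    rw [fourierInv_eq_fourier_neg, Real.fourier_real_eq_integral_exp_smul]
    refine integral_congr_ae (Filter.Eventually.of_forall fun ξ => ?_)
    simp only [hg, smul_eq_mul]
    rw [mul_comm, mul_comm (carlemanMult _ _), mul_assoc, mul_comm (carlemanMult _ _)]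
    congr 3
    push_cast
    ring
  rw [e, flip, ← integral_const_mul]
  refine norm_integral_le_of_norm_le (hf.norm.const_mul _) (Filter.Eventually.of_forall fun y => ?_)
  rw [norm_smul, mul_comm]
  exact mul_le_mul_of_nonneg_right (kernel y) (norm_nonneg _)

/-- The propagator maps `L^{8/7}` to `L⁸` with norm `O(|τ|^{-1/4})`. -/
theorem lintegral_enorm_carlemanProp_pow_eight_le {τ : ℝ} (hτ : τ ≠ 0) {f : ℝ → ℂ}
    (hf : Continuous f) (hfs : HasCompactSupport f) :
    ∫⁻ x, ‖carlemanProp τ f x‖ₑ ^ 8 ≤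
      2048 * ENNReal.ofReal (10 * |τ| ^ (-1 / 3 : ℝ)) ^ 6 * (∫⁻ y, ‖f y‖ₑ ^ (8 / 7 : ℝ)) ^ 7 := by
  have hi : Integrable f := hf.integrable_of_hasCompactSupport hfs
  have h2 : MemLp f 2 := hf.memLp_of_hasCompactSupport hfs
  have hsi : ∀ s, MeasurableSet s → Integrable (s.indicator f) := fun s hs => hi.indicator hs
  have : 0 < |τ| := abs_pos.2 hτ
  refine lintegral_enorm_pow_eight_le (T := carlemanProp τ) (by positivity) hf.measurable hi
    (continuous_carlemanProp τ hi).aemeasurable ?_ ?_ ?_ ?_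
  · intro s hs x
    rw [← carlemanProp_add τ (hsi s hs) (hsi _ hs.compl), Set.indicator_self_add_compl]
  · intro s hs x
    refine (norm_carlemanProp_le hτ (hsi s hs) x).trans (le_of_eq ?_)
    simp_rw [norm_indicator_eq_indicator_norm]
    rw [integral_indicator hs]
  · intro s hs
    refine (lintegral_enorm_carlemanProp_sq_le τ (hsi s hs) (h2.indicator hs)).trans (le_of_eq ?_)
    rw [← lintegral_indicator hs]
    refine lintegral_congr fun y => ?_
    by_cases hy : y ∈ s <;> simp [hy]
  · exact fun s hs => (continuous_carlemanProp τ (hsi s hs)).aemeasurable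

/-- The slice of `f` at time `t`, with complex values. -/
def timeSlice (f : ℝ × ℝ → ℝ) (t : ℝ) : ℝ → ℂ := fun x => (f (x, t) : ℂ)

theorem HasCompactSupport.pdx {f : ℝ × ℝ → ℝ} (hf : HasCompactSupport f) :
    HasCompactSupport (pdx f) := by
  refine HasCompactSupport.intro hf fun p hp => ?_
  have h0 : (fun x => f (x, p.2)) =ᶠ[nhds p.1] fun _ => 0 :=
    (by fun_prop : Continuous fun x : ℝ => (x, p.2)).continuousAt.eventually
      (notMem_tsupport_iff_eventuallyEq.1 hp)
  rw [_root_.pdx, h0.deriv_eq, deriv_const]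

theorem HasCompactSupport.pdt {f : ℝ × ℝ → ℝ} (hf : HasCompactSupport f) :
    HasCompactSupport (pdt f) := by
  refine HasCompactSupport.intro hf fun p hp => ?_
  have h0 : (fun t => f (p.1, t)) =ᶠ[nhds p.2] fun _ => 0 :=
    (by fun_prop : Continuous fun t : ℝ => (p.1, t)).continuousAt.eventually
      (notMem_tsupport_iff_eventuallyEq.1 hp)
  rw [_root_.pdt, h0.deriv_eq, deriv_const]

/-- A continuous compactly supported function on the plane is bounded and vanishes outside a
square. -/
theorem exists_bound_of_hasCompactSupport {f : ℝ × ℝ → ℝ} (hf : Continuous f)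
    (hfs : HasCompactSupport f) : ∃ M R : ℝ, 0 ≤ M ∧ 0 ≤ R ∧ (∀ p, |f p| ≤ M) ∧
      ∀ p, f p ≠ 0 → |p.1| ≤ R ∧ |p.2| ≤ R := by
  obtain ⟨M, hM⟩ := hfs.exists_bound_of_continuous hf
  obtain ⟨R, hR⟩ := hfs.isBounded.exists_norm_le
  refine ⟨|M|, |R|, abs_nonneg _, abs_nonneg _, fun p => (hM p).trans (le_abs_self M),
    fun p hp => ?_⟩
  have := (hR p (subset_tsupport f hp)).trans (le_abs_self R)
  exact ⟨(norm_fst_le p).trans this, (norm_snd_le p).trans this⟩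

section Slices

variable {f : ℝ × ℝ → ℝ}

theorem continuous_timeSlice (hf : Continuous f) (t : ℝ) : Continuous (timeSlice f t) := by
  unfold timeSlice; fun_prop

theorem hasCompactSupport_timeSlice (hf : Continuous f) (hfs : HasCompactSupport f) (t : ℝ) :
    HasCompactSupport (timeSlice f t) := by
  obtain ⟨M, R, -, -, -, hR⟩ := exists_bound_of_hasCompactSupport hf hfs
  refine HasCompactSupport.intro (isCompact_Icc (a := -R) (b := R)) fun x hx => ?_
  by_contra h
  exact hx (abs_le.1 (hR (x, t) fun h0 => h (by simp [timeSlice, h0])).1)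

theorem integrable_timeSlice (hf : Continuous f) (hfs : HasCompactSupport f) (t : ℝ) :
    Integrable (timeSlice f t) :=
  (continuous_timeSlice hf t).integrable_of_hasCompactSupport (hasCompactSupport_timeSlice hf hfs t)

open FourierTransform Real in
theorem continuous_fourier_timeSlice (hf : Continuous f) (hfs : HasCompactSupport f) :
    Continuous fun p : ℝ × ℝ => 𝓕 (timeSlice f p.2) p.1 := by
  obtain ⟨M, R, hM0, hR0, hM, hR⟩ := exists_bound_of_hasCompactSupport hf hfs
  simp_rw [Real.fourier_real_eq_integral_exp_smul]
  have ic : IntegrableOn (fun _ : ℝ => M) (Set.Icc (-R) R) := by simp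
  refine continuous_of_dominated (bound := (Set.Icc (-R) R).indicator fun _ => M) ?_ ?_
    (ic.integrable_indicator measurableSet_Icc) ?_
  · intro p
    unfold timeSlice
    fun_prop
  · refine fun p => Filter.Eventually.of_forall fun y => ?_
    rw [norm_smul, Complex.norm_exp_ofReal_mul_I, one_mul, timeSlice, Complex.norm_real,
      Real.norm_eq_abs]
    by_cases hy : y ∈ Set.Icc (-R) R
    · rw [Set.indicator_of_mem hy]; exact hM _
    · rw [Set.indicator_of_notMem hy]
      have : f (y, p.2) = 0 := by
        by_contra h
        exact hy (abs_le.1 (hR _ h).1)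
      simp [this]
  · refine Filter.Eventually.of_forall fun y => ?_
    unfold timeSlice
    fun_prop

open FourierTransform Real in
theorem exists_norm_fourier_timeSlice_le (hf : Continuous f) (hfs : HasCompactSupport f) :
    ∃ M R : ℝ, 0 ≤ R ∧ ∀ s ξ,
      ‖𝓕 (timeSlice f s) ξ‖ ≤ (Set.Icc (-R) R).indicator (fun _ => M) s := by
  obtain ⟨M, R, hM0, hR0, hM, hR⟩ := exists_bound_of_hasCompactSupport hf hfs
  refine ⟨2 * R * M, R, hR0, fun s ξ => ?_⟩
  by_cases hs : s ∈ Set.Icc (-R) R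
  · rw [Set.indicator_of_mem hs]
    refine (norm_fourier_le _ _).trans ?_
    have ic : IntegrableOn (fun _ : ℝ => M) (Set.Icc (-R) R) := by simp
    calc ∫ y, ‖timeSlice f s y‖ ≤ ∫ y, (Set.Icc (-R) R).indicator (fun _ => M) y := by
          refine integral_mono (integrable_timeSlice hf hfs s).norm
            (ic.integrable_indicator measurableSet_Icc) fun y => ?_
          simp only [timeSlice, Complex.norm_real, Real.norm_eq_abs]
          by_cases hy : y ∈ Set.Icc (-R) R
          · rw [Set.indicator_of_mem hy]; exact hM _
          · rw [Set.indicator_of_notMem hy, abs_nonpos_iff]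
            by_contra h
            exact hy (abs_le.1 (hR _ h).1)
      _ = 2 * R * M := by
          rw [integral_indicator measurableSet_Icc, setIntegral_const, Real.volume_real_Icc_of_le
            (by linarith), smul_eq_mul]
          ring
  · have : timeSlice f s = 0 := by
      ext y
      have : f (y, s) = 0 := by
        by_contra h
        exact hs (abs_le.1 (hR _ h).2)
      simp [timeSlice, this]
    rw [Set.indicator_of_notMem hs, this, Real.fourier_real_eq]
    simp

open FourierTransform Real Complex in
theorem fourier_timeSlice_pdx (hf : Continuous f) (hfs : HasCompactSupport f)
    (hd : ∀ t, Differentiable ℝ fun x => f (x, t)) (hf' : Continuous (pdx f)) (t ξ : ℝ) :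
    𝓕 (timeSlice (pdx f) t) ξ = 2 * π * I * ξ * 𝓕 (timeSlice f t) ξ := by
  have d : ∀ x, HasDerivAt (timeSlice f t) (timeSlice (pdx f) t x) x := fun x =>
    (hd t x).hasDerivAt.ofReal_comp
  have e : deriv (timeSlice f t) = timeSlice (pdx f) t := funext fun x => (d x).deriv
  rw [← e, Real.fourier_deriv (integrable_timeSlice hf hfs t)
    (fun x => (d x).differentiableAt) (e ▸ integrable_timeSlice hf' hfs.pdx t)]
  rfl

open FourierTransform Real Complex in
theorem hasDerivAt_fourier_timeSlice (hf : Continuous f) (hfs : HasCompactSupport f)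
    (hd : ∀ x, Differentiable ℝ fun t => f (x, t)) (hf' : Continuous (pdt f)) (t ξ : ℝ) :
    HasDerivAt (fun t => 𝓕 (timeSlice f t) ξ) (𝓕 (timeSlice (pdt f) t) ξ) t := by
  obtain ⟨M, R, hM0, hR0, hM, hR⟩ := exists_bound_of_hasCompactSupport hf' hfs.pdt
  have ic : IntegrableOn (fun _ : ℝ => M) (Set.Icc (-R) R) := by simp
  simp_rw [Real.fourier_real_eq_integral_exp_smul]
  refine (hasDerivAt_integral_of_dominated_loc_of_deriv_le (𝕜 := ℝ) (x₀ := t)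
    (F := fun s y => cexp (((-2 * π * y * ξ : ℝ) : ℂ) * I) • timeSlice f s y)
    (F' := fun s y => cexp (((-2 * π * y * ξ : ℝ) : ℂ) * I) • timeSlice (pdt f) s y)
    (bound := (Set.Icc (-R) R).indicator fun _ => M) Filter.univ_mem ?_ ?_ ?_ ?_
    (ic.integrable_indicator measurableSet_Icc) ?_).2
  · refine Filter.Eventually.of_forall fun s => ?_
    unfold timeSlice
    fun_prop
  · refine (integrable_timeSlice hf hfs t).bdd_mul (c := 1) (by fun_prop)
      (Filter.Eventually.of_forall fun y => ?_)
    rw [norm_exp_ofReal_mul_I]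
  · unfold timeSlice
    fun_prop
  · refine Filter.Eventually.of_forall fun y s _ => ?_
    rw [norm_smul, norm_exp_ofReal_mul_I, one_mul, timeSlice, norm_real, Real.norm_eq_abs]
    by_cases hy : y ∈ Set.Icc (-R) R
    · rw [Set.indicator_of_mem hy]; exact hM _
    · rw [Set.indicator_of_notMem hy, abs_nonpos_iff]
      by_contra h
      exact hy (abs_le.1 (hR _ h).1)
  · exact Filter.Eventually.of_forall fun y s _ =>
      ((hd y s).hasDerivAt.ofReal_comp).const_mul (cexp (((-2 * π * y * ξ : ℝ) : ℂ) * I))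

end Slices

open Complex in
/-- The bounded solution formula for the scalar equation `u' = carlemanSymbol w * u + G`. -/
theorem eq_integral_carlemanMult_mul {u G : ℝ → ℂ} {w : ℝ}
    (hu : ∀ t, HasDerivAt u (carlemanSymbol w * u t + G t) t) (hG : Continuous G)
    (hus : HasCompactSupport u) (t : ℝ) : u t = ∫ s, carlemanMult (t - s) w * G s := by
  set v : ℝ → ℂ := fun s => cexp ((t - s : ℝ) * carlemanSymbol w) * u s with hv
  have dv : ∀ s, HasDerivAt v (cexp ((t - s : ℝ) * carlemanSymbol w) * G s) s := by
    intro s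
    have h1 : HasDerivAt (fun s : ℝ => ((t - s : ℝ) : ℂ) * carlemanSymbol w)
        (-carlemanSymbol w) s := by
      have := (((hasDerivAt_id s).const_sub t).ofReal_comp).mul_const (carlemanSymbol w)
      simpa using this
    refine (h1.cexp.mul (hu s)).congr_deriv ?_
    ring
  have dv' : deriv v = fun s => cexp ((t - s : ℝ) * carlemanSymbol w) * G s :=
    funext fun s => (dv s).deriv
  have cv : ContDiff ℝ 1 v := by
    rw [contDiff_one_iff_deriv, dv']
    exact ⟨fun s => (dv s).differentiableAt, by fun_prop⟩
  have sv : HasCompactSupport v := hus.mul_left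
  have vt : v t = u t := by simp [hv]
  rcases lt_or_ge 1 (3 * w ^ 2) with hw | hw
  · have e : ∀ s, carlemanMult (t - s) w * G s = (Set.Iio t).indicator (deriv v) s := by
      intro s
      by_cases hs : s < t
      · rw [Set.indicator_of_mem (show s ∈ Set.Iio t from hs), dv', carlemanMult,
          if_pos (sub_pos.2 hs), if_pos hw]
      · rw [Set.indicator_of_notMem (show s ∉ Set.Iio t from hs), carlemanMult,
          if_neg (fun h => hs (sub_pos.1 h)), if_neg hw.not_ge, zero_mul]
    simp_rw [e]
    rw [integral_indicator measurableSet_Iio, setIntegral_congr_set Iio_ae_eq_Iic,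
      sv.integral_Iic_deriv_eq cv, vt]
  · have e : ∀ s, carlemanMult (t - s) w * G s = (Set.Ici t).indicator (fun s => -deriv v s) s := by
      intro s
      by_cases hs : s < t
      · rw [Set.indicator_of_notMem (show s ∉ Set.Ici t from not_le.2 hs), carlemanMult,
          if_pos (sub_pos.2 hs), if_neg hw.not_gt, zero_mul]
      · rw [Set.indicator_of_mem (show s ∈ Set.Ici t from not_lt.1 hs), dv', carlemanMult,
          if_neg (fun h => hs (sub_pos.1 h)), if_pos hw, neg_mul]
    simp_rw [e]
    rw [integral_indicator measurableSet_Ici, integral_neg, setIntegral_congr_set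
      Ioi_ae_eq_Ici.symm, sv.integral_Ioi_deriv_eq cv, vt, neg_neg]

theorem integrable_indicator_rpow (t R : ℝ) : Integrable
    ((Set.Icc (-R) R).indicator fun s => 1 + |t - s| ^ (-3 / 4 : ℝ)) := by
  have h0 : ∀ a b : ℝ, IntervalIntegrable (fun z : ℝ => |z| ^ (-3 / 4 : ℝ)) volume a b := by
    refine fun a b => intervalIntegrable_of_even (fun z => by rw [abs_neg]) fun z hz => ?_
    refine (intervalIntegral.intervalIntegrable_rpow' (r := -3 / 4) (by norm_num)).congr
      fun y hy => ?_
    rw [Set.uIoc_of_le hz.le] at hy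
    simp only [abs_of_pos hy.1]
  rcases lt_or_ge R (-R) with hR | hR
  · rw [Set.Icc_eq_empty (not_le.2 hR), Set.indicator_empty]
    exact integrable_zero _ _ _
  rw [integrable_indicator_iff measurableSet_Icc, integrableOn_Icc_iff_integrableOn_Ioc,
    ← intervalIntegrable_iff_integrableOn_Ioc_of_le hR]
  have h1 := (h0 (t + R) (t - R)).comp_sub_left t
  simp only [sub_add_cancel_left, sub_sub_cancel] at h1
  exact intervalIntegrable_const.add h1

open FourierTransform Real in
theorem integrable_carlemanMult_mul_fourier_timeSlice {f : ℝ × ℝ → ℝ} (hf : Continuous f)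
    (hfs : HasCompactSupport f) (t : ℝ) :
    Integrable fun p : ℝ × ℝ => carlemanMult (t - p.2) (2 * π * p.1) * 𝓕 (timeSlice f p.2) p.1 := by
  obtain ⟨M, R, hR, hM⟩ := exists_norm_fourier_timeSlice_le hf hfs
  have i1 : Integrable fun ξ : ℝ => 6 * M * (1 + (2 * π * ξ) ^ 2) ^ (-3 / 4 : ℝ) :=
    (integrable_one_add_sq_rpow.comp_mul_left' (by positivity)).const_mul _
  refine (i1.mul_prod (integrable_indicator_rpow t R)).mono' ?_
    (Filter.Eventually.of_forall fun p => ?_)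
  · refine Measurable.aestronglyMeasurable (Measurable.mul ?_
      (continuous_fourier_timeSlice hf hfs).measurable)
    exact measurable_carlemanMult.comp
      (by fun_prop : Measurable fun p : ℝ × ℝ => (t - p.2, 2 * π * p.1))
  · have h1 := norm_carlemanMult_le (t - p.2) (2 * π * p.1)
    have h2 := hM p.2 p.1
    rw [norm_mul]
    by_cases hs : p.2 ∈ Set.Icc (-R) R
    · rw [Set.indicator_of_mem hs] at h2 ⊢
      calc _ ≤ _ := mul_le_mul h1 h2 (norm_nonneg _) (by positivity)
        _ = _ := by ring
    · rw [Set.indicator_of_notMem hs] at h2 ⊢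
      rw [le_antisymm h2 (norm_nonneg _), mul_zero, mul_zero]

/-- The differential operator `∂ₜ + ∂ₓ³ - 3 ∂ₓ² - 1`. -/
noncomputable def carlemanOp (h : ℝ × ℝ → ℝ) : ℝ × ℝ → ℝ :=
  fun p => pdt h p + pdx (pdx (pdx h)) p - 3 * pdx (pdx h) p - h p

open FourierTransform Real Complex in
theorem carlemanProp_eq_integral (τ : ℝ) (f : ℝ → ℂ) (x : ℝ) : carlemanProp τ f x =
    ∫ ξ : ℝ, cexp ((-2 * π * ξ * -x : ℝ) * I) * (carlemanMult τ (2 * π * ξ) * 𝓕 f ξ) := by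
  rw [carlemanProp, fourierInv_eq_fourier_neg, Real.fourier_real_eq_integral_exp_smul]
  rfl

section Representation

variable {h : ℝ × ℝ → ℝ}

theorem continuous_carlemanOp (hc : C31 h) : Continuous (carlemanOp h) := by
  obtain ⟨-, -, c0, -, c2, c3, ct⟩ := hc
  unfold carlemanOp
  fun_prop

theorem hasCompactSupport_carlemanOp (hs : HasCompactSupport h) :
    HasCompactSupport (carlemanOp h) :=
  ((hs.pdt.add hs.pdx.pdx.pdx).sub (hs.pdx.pdx.mul_left (f := fun _ => 3))).sub hs

open FourierTransform in
theorem fourier_timeSlice_carlemanOp (hc : C31 h) (hs : HasCompactSupport h) (t ξ : ℝ) :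
    𝓕 (timeSlice (carlemanOp h) t) ξ = 𝓕 (timeSlice (pdt h) t) ξ +
      𝓕 (timeSlice (pdx (pdx (pdx h))) t) ξ - 3 * 𝓕 (timeSlice (pdx (pdx h)) t) ξ -
      𝓕 (timeSlice h t) ξ := by
  obtain ⟨-, -, c0, -, c2, c3, ct⟩ := hc
  have i : ∀ {f : ℝ × ℝ → ℝ}, Continuous f → HasCompactSupport f →
      Integrable fun y : ℝ => Complex.exp ((-2 * Real.pi * y * ξ : ℝ) * Complex.I) *
        timeSlice f t y := fun {f} hf hfs =>
    (integrable_timeSlice hf hfs t).bdd_mul (c := 1) (by fun_prop)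
      (Filter.Eventually.of_forall fun y => le_of_eq (Complex.norm_exp_ofReal_mul_I _))
  simp_rw [Real.fourier_real_eq_integral_exp_smul, smul_eq_mul]
  rw [← integral_const_mul]
  have hsum : Integrable fun y : ℝ =>
      Complex.exp ((-2 * Real.pi * y * ξ : ℝ) * Complex.I) * timeSlice (pdt h) t y +
      Complex.exp ((-2 * Real.pi * y * ξ : ℝ) * Complex.I) * timeSlice (pdx (pdx (pdx h))) t y :=
    (i ct hs.pdt).add (i c3 hs.pdx.pdx.pdx)
  have sub : Integrable fun y : ℝ =>
      Complex.exp ((-2 * Real.pi * y * ξ : ℝ) * Complex.I) * timeSlice (pdt h) t y +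
      Complex.exp ((-2 * Real.pi * y * ξ : ℝ) * Complex.I) * timeSlice (pdx (pdx (pdx h))) t y -
      3 * (Complex.exp ((-2 * Real.pi * y * ξ : ℝ) * Complex.I) * timeSlice (pdx (pdx h)) t y) :=
    hsum.sub ((i c2 hs.pdx.pdx).const_mul _)
  rw [← integral_add (i ct hs.pdt) (i c3 hs.pdx.pdx.pdx),
    ← integral_sub hsum ((i c2 hs.pdx.pdx).const_mul _), ← integral_sub sub (i c0 hs)]
  refine integral_congr_ae (Filter.Eventually.of_forall fun y => ?_)
  simp only [timeSlice, carlemanOp]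
  push_cast
  ring

theorem contDiff_pdx {f : ℝ × ℝ → ℝ} {n : ℕ}
    (hf : ∀ t, ContDiff ℝ (n + 1 : ℕ) fun x => f (x, t)) (t : ℝ) :
    ContDiff ℝ n fun x => pdx f (x, t) := by
  have := hf t
  push_cast at this
  exact (contDiff_succ_iff_deriv.1 this).2.2

open FourierTransform Real in
theorem fourier_timeSlice_eq_integral (hc : C31 h) (hs : HasCompactSupport h) (t ξ : ℝ) :
    𝓕 (timeSlice h t) ξ =
      ∫ s, carlemanMult (t - s) (2 * π * ξ) * 𝓕 (timeSlice (carlemanOp h) s) ξ := by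
  have hF := continuous_carlemanOp hc
  have hFs := hasCompactSupport_carlemanOp hs
  have hc' := hc
  obtain ⟨cx, dt, c0, c1, c2, c3, ct⟩ := hc
  have d1 : ∀ t, ContDiff ℝ (2 : ℕ) fun x => pdx h (x, t) := contDiff_pdx cx
  have d2 : ∀ t, ContDiff ℝ (1 : ℕ) fun x => pdx (pdx h) (x, t) := contDiff_pdx d1
  refine eq_integral_carlemanMult_mul (u := fun t => 𝓕 (timeSlice h t) ξ)
    (G := fun s => 𝓕 (timeSlice (carlemanOp h) s) ξ) (fun t => ?_) ?_ ?_ t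
  · refine (hasDerivAt_fourier_timeSlice c0 hs dt ct t ξ).congr_deriv ?_
    rw [fourier_timeSlice_carlemanOp hc' hs,
      fourier_timeSlice_pdx c2 hs.pdx.pdx (fun t => (d2 t).differentiable (by norm_num)) c3,
      fourier_timeSlice_pdx c1 hs.pdx (fun t => (d1 t).differentiable (by norm_num)) c2,
      fourier_timeSlice_pdx c0 hs (fun t => (cx t).differentiable (by norm_num)) c1]
    simp only [carlemanSymbol]
    push_cast
    linear_combination (-8 * (π : ℂ) ^ 3 * ξ ^ 3 * Complex.I * 𝓕 (timeSlice h t) ξ +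
      12 * (π : ℂ) ^ 2 * ξ ^ 2 * 𝓕 (timeSlice h t) ξ) * Complex.I_sq
  · exact (continuous_fourier_timeSlice hF hFs).comp (by fun_prop : Continuous fun s : ℝ => (ξ, s))
  · obtain ⟨M, R, -, hM⟩ := exists_norm_fourier_timeSlice_le c0 hs
    refine HasCompactSupport.intro (isCompact_Icc (a := -R) (b := R)) fun s hs => ?_
    have := hM s ξ
    rwa [Set.indicator_of_notMem hs, norm_le_zero_iff] at this

open FourierTransform Real Complex in
theorem eq_integral_carlemanProp (hc : C31 h) (hs : HasCompactSupport h) (x t : ℝ) :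
    (h (x, t) : ℂ) = ∫ s, carlemanProp (t - s) (timeSlice (carlemanOp h) s) x := by
  have int := integrable_carlemanMult_mul_fourier_timeSlice (continuous_carlemanOp hc)
    (hasCompactSupport_carlemanOp hs) t
  have c0 : Continuous h := hc.2.2.1
  have e : 𝓕 (timeSlice h t) = fun ξ =>
      ∫ s, carlemanMult (t - s) (2 * π * ξ) * 𝓕 (timeSlice (carlemanOp h) s) ξ :=
    funext fun ξ => fourier_timeSlice_eq_integral hc hs t ξ
  have hi : Integrable (𝓕 (timeSlice h t)) := by
    rw [e]
    exact int.integral_prod_left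
  have inv := congrFun ((continuous_timeSlice c0 t).fourierInv_fourier_eq
    (integrable_timeSlice c0 hs t) hi) x
  have char : ∀ ξ : ℝ, ‖cexp ((-2 * π * ξ * -x : ℝ) * I)‖ ≤ 1 := fun ξ =>
    le_of_eq (norm_exp_ofReal_mul_I _)
  have int' : Integrable (fun p : ℝ × ℝ => cexp ((-2 * π * p.1 * -x : ℝ) * I) *
      (carlemanMult (t - p.2) (2 * π * p.1) * 𝓕 (timeSlice (carlemanOp h) p.2) p.1))
      (volume.prod volume) :=
    int.bdd_mul (c := 1) (by fun_prop) (Filter.Eventually.of_forall fun p => char p.1)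
  change timeSlice h t x = _
  rw [← inv, fourierInv_eq_fourier_neg, Real.fourier_real_eq_integral_exp_smul, e]
  simp_rw [carlemanProp_eq_integral, smul_eq_mul, ← integral_const_mul]
  exact integral_integral_swap int'

open FourierTransform Real Complex in
theorem stronglyMeasurable_carlemanProp_timeSlice {f : ℝ × ℝ → ℝ} (hf : Continuous f)
    (hfs : HasCompactSupport f) : StronglyMeasurable fun q : (ℝ × ℝ) × ℝ =>
      carlemanProp (q.1.2 - q.2) (timeSlice f q.2) q.1.1 := by
  have m : Measurable fun r : ((ℝ × ℝ) × ℝ) × ℝ =>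
      cexp ((-2 * π * r.2 * -r.1.1.1 : ℝ) * I) *
        (carlemanMult (r.1.1.2 - r.1.2) (2 * π * r.2) * 𝓕 (timeSlice f r.1.2) r.2) := by
    have m1 : Measurable fun r : ((ℝ × ℝ) × ℝ) × ℝ =>
        carlemanMult (r.1.1.2 - r.1.2) (2 * π * r.2) := measurable_carlemanMult.comp
      (by fun_prop : Measurable fun r : ((ℝ × ℝ) × ℝ) × ℝ => (r.1.1.2 - r.1.2, 2 * π * r.2))
    have m2 := (continuous_fourier_timeSlice hf hfs).measurable.comp
      (by fun_prop : Measurable fun r : ((ℝ × ℝ) × ℝ) × ℝ => (r.2, r.1.2))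
    exact Measurable.mul (by fun_prop) (m1.mul m2)
  simp_rw [carlemanProp_eq_integral]
  exact m.stronglyMeasurable.integral_prod_right

end Representation

section Assembly

variable {h : ℝ × ℝ → ℝ}

theorem enorm_le_lintegral_enorm_carlemanProp (hc : C31 h) (hs : HasCompactSupport h) (x t : ℝ) :
    ‖h (x, t)‖ₑ ≤ ∫⁻ s, ‖carlemanProp (t - s) (timeSlice (carlemanOp h) s) x‖ₑ := by
  have e : ‖h (x, t)‖ₑ = ‖(h (x, t) : ℂ)‖ₑ := by
    rw [← ofReal_norm, ← ofReal_norm, Complex.norm_real]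
  rw [e, eq_integral_carlemanProp hc hs]
  exact enorm_integral_le_lintegral_enorm _

theorem lintegral_carlemanProp_timeSlice_rpow_le {f : ℝ × ℝ → ℝ} (hf : Continuous f)
    (hfs : HasCompactSupport f) {t s : ℝ} (hts : s ≠ t) :
    (∫⁻ x, ‖carlemanProp (t - s) (timeSlice f s) x‖ₑ ^ (8 : ℝ)) ^ (1 / 8 : ℝ) ≤
      15 * (∫⁻ x, ‖f (x, s)‖ₑ ^ (8 / 7 : ℝ)) ^ (7 / 8 : ℝ) *
        ENNReal.ofReal (|t - s| ^ (-1 / 4 : ℝ)) := by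
  have hτ : t - s ≠ 0 := sub_ne_zero.2 hts.symm
  have hτ' : 0 < |t - s| := abs_pos.2 hτ
  have key := lintegral_enorm_carlemanProp_pow_eight_le hτ (continuous_timeSlice hf s)
    (hasCompactSupport_timeSlice hf hfs s)
  have e : ∀ y, ‖timeSlice f s y‖ₑ = ‖f (y, s)‖ₑ := fun y => by
    rw [← ofReal_norm, ← ofReal_norm, timeSlice, Complex.norm_real]
  simp_rw [e] at key
  set N := ∫⁻ x, ‖f (x, s)‖ₑ ^ (8 / 7 : ℝ)
  have le : 2048 * ENNReal.ofReal (10 * |t - s| ^ (-1 / 3 : ℝ)) ^ 6 ≤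
      (15 * ENNReal.ofReal (|t - s| ^ (-1 / 4 : ℝ))) ^ (8 : ℝ) := by
    have e1 : (|t - s| ^ (-1 / 3 : ℝ)) ^ 6 = |t - s| ^ (-2 : ℝ) := by
      rw [← Real.rpow_mul_natCast hτ'.le]; norm_num
    have e2 : (|t - s| ^ (-1 / 4 : ℝ)) ^ 8 = |t - s| ^ (-2 : ℝ) := by
      rw [← Real.rpow_mul_natCast hτ'.le]; norm_num
    rw [show (8 : ℝ) = (8 : ℕ) by norm_num, ENNReal.rpow_natCast,
      show (15 : ENNReal) = ENNReal.ofReal 15 by norm_num,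
      show (2048 : ENNReal) = ENNReal.ofReal 2048 by norm_num,
      ← ENNReal.ofReal_mul (by norm_num), ← ENNReal.ofReal_pow (by positivity),
      ← ENNReal.ofReal_pow (by positivity), ← ENNReal.ofReal_mul (by norm_num), mul_pow, mul_pow,
      e1, e2]
    apply ENNReal.ofReal_le_ofReal
    have : 0 ≤ |t - s| ^ (-2 : ℝ) := by positivity
    nlinarith
  calc _ ≤ ((15 * ENNReal.ofReal (|t - s| ^ (-1 / 4 : ℝ))) ^ (8 : ℝ) * N ^ (7 : ℝ)) ^
        (1 / 8 : ℝ) := by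
        gcongr
        refine le_trans (le_of_eq ?_) (key.trans ?_)
        · refine lintegral_congr fun x => ?_
          exact_mod_cast ENNReal.rpow_natCast _ 8
        · rw [show N ^ (7 : ℝ) = N ^ 7 by exact_mod_cast ENNReal.rpow_natCast _ 7]
          gcongr
    _ = _ := by
        rw [ENNReal.mul_rpow_of_nonneg _ _ (by norm_num), ← ENNReal.rpow_mul, ← ENNReal.rpow_mul,
          show (8 : ℝ) * (1 / 8) = 1 by norm_num, ENNReal.rpow_one,
          show (7 : ℝ) * (1 / 8) = 7 / 8 by norm_num, mul_right_comm]

theorem lintegral_enorm_pow_slice_le (hc : C31 h) (hs : HasCompactSupport h) (t : ℝ) :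
    ∫⁻ x, ‖h (x, t)‖ₑ ^ (8 : ℝ) ≤ ∫⁻ s, 15 * ((∫⁻ x, ‖h (x, t)‖ₑ ^ (8 : ℝ)) ^ (7 / 8 : ℝ) *
      (∫⁻ x, ‖carlemanOp h (x, s)‖ₑ ^ (8 / 7 : ℝ)) ^ (7 / 8 : ℝ) *
        ENNReal.ofReal (|t - s| ^ (-1 / 4 : ℝ))) := by
  have hF := continuous_carlemanOp hc
  have hFs := hasCompactSupport_carlemanOp hs
  have c0 : Continuous h := hc.2.2.1
  have mK : Measurable fun q : ℝ × ℝ =>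
      ‖carlemanProp (t - q.2) (timeSlice (carlemanOp h) q.2) q.1‖ₑ := by
    have := (stronglyMeasurable_carlemanProp_timeSlice hF hFs).measurable.comp
      (by fun_prop : Measurable fun q : ℝ × ℝ => ((q.1, t), q.2))
    exact this.enorm
  have mh : Measurable fun x => ‖h (x, t)‖ₑ ^ (7 : ℝ) :=
    (by fun_prop : Continuous fun x => h (x, t)).measurable.enorm.pow_const _
  have mKs : ∀ s, Measurable fun x =>
      ‖carlemanProp (t - s) (timeSlice (carlemanOp h) s) x‖ₑ := fun s => by
    have := mK.comp (by fun_prop : Measurable fun x : ℝ => (x, s))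
    exact this
  have mKx : ∀ x, Measurable fun s =>
      ‖carlemanProp (t - s) (timeSlice (carlemanOp h) s) x‖ₑ := fun x => by
    have := mK.comp (by fun_prop : Measurable fun s : ℝ => (x, s))
    exact this
  calc ∫⁻ x, ‖h (x, t)‖ₑ ^ (8 : ℝ)
      ≤ ∫⁻ x, ∫⁻ s, ‖h (x, t)‖ₑ ^ (7 : ℝ) *
          ‖carlemanProp (t - s) (timeSlice (carlemanOp h) s) x‖ₑ := by
        refine lintegral_mono fun x => ?_
        rw [lintegral_const_mul _ (mKx x), show (8 : ℝ) = 7 + 1 by norm_num,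
          ENNReal.rpow_add_of_nonneg _ _ (by norm_num) (by norm_num), ENNReal.rpow_one]
        gcongr
        exact enorm_le_lintegral_enorm_carlemanProp hc hs x t
    _ = ∫⁻ s, ∫⁻ x, ‖h (x, t)‖ₑ ^ (7 : ℝ) *
          ‖carlemanProp (t - s) (timeSlice (carlemanOp h) s) x‖ₑ :=
        lintegral_lintegral_swap ((mh.comp measurable_fst).mul mK).aemeasurable
    _ ≤ _ := by
        refine lintegral_mono_ae ?_
        filter_upwards [Measure.ae_ne volume t] with s hts
        refine (ENNReal.lintegral_mul_le_Lp_mul_Lq volume (p := 8 / 7) (q := 8)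
          (by constructor <;> norm_num) mh.aemeasurable (mKs s).aemeasurable).trans ?_
        simp_rw [← ENNReal.rpow_mul]
        rw [show (7 : ℝ) * (8 / 7) = 8 by norm_num, show (1 : ℝ) / (8 / 7) = 7 / 8 by norm_num]
        refine (mul_le_mul_right (lintegral_carlemanProp_timeSlice_rpow_le hF hFs hts) _).trans
          (le_of_eq ?_)
        ring

theorem lintegral_enorm_pow_le (hc : C31 h) (hs : HasCompactSupport h) :
    ∫⁻ p, ‖h p‖ₑ ^ (8 : ℝ) ≤ 150 * (∫⁻ p, ‖h p‖ₑ ^ (8 : ℝ)) ^ (7 / 8 : ℝ) *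
      (∫⁻ p, ‖carlemanOp h p‖ₑ ^ (8 / 7 : ℝ)) ^ (7 / 8 : ℝ) := by
  have m : ∀ {f : ℝ × ℝ → ℝ} (r : ℝ), Continuous f → Measurable fun p => ‖f p‖ₑ ^ r :=
    fun {f} r hf => (by fun_prop : Measurable fun p => ‖f p‖ₑ).pow_const r
  have slice : ∀ {f : ℝ × ℝ → ℝ} (r : ℝ), Continuous f →
      ∫⁻ p, ‖f p‖ₑ ^ r = ∫⁻ t, ∫⁻ x, ‖f (x, t)‖ₑ ^ r := fun {f} r hf =>
    lintegral_prod_symm' _ (m r hf)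
  have c0 : Continuous h := hc.2.2.1
  have hF := continuous_carlemanOp hc
  have ma := (m 8 c0).lintegral_prod_left' (μ := (volume : Measure ℝ))
  have mb := (m (8 / 7) hF).lintegral_prod_left' (μ := (volume : Measure ℝ))
  have cancel : ∀ a : ENNReal, (a ^ (7 / 8 : ℝ)) ^ (8 / 7 : ℝ) = a := fun a => by
    rw [← ENNReal.rpow_mul, show (7 / 8 : ℝ) * (8 / 7) = 1 by norm_num, ENNReal.rpow_one]
  rw [slice 8 c0, slice (8 / 7) hF]
  calc _ ≤ ∫⁻ t, ∫⁻ s, 15 * ((∫⁻ x, ‖h (x, t)‖ₑ ^ (8 : ℝ)) ^ (7 / 8 : ℝ) *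
      (∫⁻ x, ‖carlemanOp h (x, s)‖ₑ ^ (8 / 7 : ℝ)) ^ (7 / 8 : ℝ) *
        ENNReal.ofReal (|t - s| ^ (-1 / 4 : ℝ))) :=
        lintegral_mono fun t => lintegral_enorm_pow_slice_le hc hs t
    _ = 15 * ∫⁻ t, ∫⁻ s, (∫⁻ x, ‖h (x, t)‖ₑ ^ (8 : ℝ)) ^ (7 / 8 : ℝ) *
      (∫⁻ x, ‖carlemanOp h (x, s)‖ₑ ^ (8 / 7 : ℝ)) ^ (7 / 8 : ℝ) *
        ENNReal.ofReal (|t - s| ^ (-1 / 4 : ℝ)) := by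
        simp_rw [lintegral_const_mul' _ _ (show (15 : ENNReal) ≠ ⊤ by norm_num)]
    _ ≤ _ := by
        have hls := lintegral_lintegral_rpow_le (ma.pow_const (7 / 8 : ℝ))
          (mb.pow_const (7 / 8 : ℝ))
        simp_rw [cancel] at hls
        refine (mul_le_mul_right hls 15).trans (le_of_eq ?_)
        ring

end Assembly

theorem stmt6 : ∃ c : ℝ, 0 < c ∧ ∀ h : ℝ × ℝ → ℝ, C31 h → HasCompactSupport h →
    eLpNorm h 8 volume ≤
      ENNReal.ofReal c *
        eLpNorm (fun p => pdt h p + pdx (pdx (pdx h)) p - 3 * pdx (pdx h) p - h p)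
          (8/7) volume := by
  refine ⟨150, by norm_num, fun h hc hs => ?_⟩
  change eLpNorm h 8 volume ≤ ENNReal.ofReal 150 * eLpNorm (carlemanOp h) (8 / 7) volume
  have key := lintegral_enorm_pow_le hc hs
  have mem : MemLp h 8 volume := hc.2.2.1.memLp_of_hasCompactSupport hs
  have e7 : ((8 / 7 : ENNReal)).toReal = 8 / 7 := by simp
  have e1 : eLpNorm h 8 volume = (∫⁻ p, ‖h p‖ₑ ^ (8 : ℝ)) ^ (1 / 8 : ℝ) := by
    rw [eLpNorm_eq_lintegral_rpow_enorm_toReal (by norm_num) (by norm_num)]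
    norm_num
  have e2 : eLpNorm (carlemanOp h) (8 / 7) volume =
      (∫⁻ p, ‖carlemanOp h p‖ₑ ^ (8 / 7 : ℝ)) ^ (7 / 8 : ℝ) := by
    rw [eLpNorm_eq_lintegral_rpow_enorm_toReal (by norm_num)
      (ENNReal.div_ne_top (by norm_num) (by norm_num)), e7]
    norm_num
  have fin := mem.2.ne
  rw [e1] at fin
  rw [e1, e2, show ENNReal.ofReal 150 = 150 by norm_num]
  set A := ∫⁻ p, ‖h p‖ₑ ^ (8 : ℝ)
  set B := ∫⁻ p, ‖carlemanOp h p‖ₑ ^ (8 / 7 : ℝ)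
  rcases eq_or_ne A 0 with h0 | h0
  · rw [h0, ENNReal.zero_rpow_of_pos (by norm_num)]
    exact zero_le
  have ht : A ≠ ⊤ := fun h => fin (by rw [h, ENNReal.top_rpow_of_pos (by norm_num)])
  have h7 : A ^ (7 / 8 : ℝ) ≠ 0 := by simp [ENNReal.rpow_eq_zero_iff, h0, ht]
  have h7' : A ^ (7 / 8 : ℝ) ≠ ⊤ := ENNReal.rpow_ne_top_of_nonneg (by norm_num) ht
  rw [← ENNReal.mul_le_mul_iff_right h7 h7', ← ENNReal.rpow_add _ _ h0 ht,
    show (7 / 8 + 1 / 8 : ℝ) = 1 by norm_num, ENNReal.rpow_one]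
  exact key.trans (le_of_eq (by ring))
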